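/- arXiv:2006.14139 — 4 statements merged into one kernel-verified Lean document; each statement's English description precedes it below -/
import Mathlib

section
/- Every four-element generating set of the partition lattice Part(5) is an antichain; consequently, Part(5) has no (1+1+2)-generating set. -/
namespace PartitionLattice

/-- The smaller endpoint of the `k`-th edge of the complete graph on `Fin 5`. -/
def src : Fin 10 → Fin 5 := ![0, 0, 1, 0, 1, 2, 0, 1, 2, 3]

/-- The larger endpoint of the `k`-th edge of the complete graph on `Fin 5`. -/
def tgt : Fin 10 → Fin 5 := ![1, 2, 2, 3, 3, 3, 4, 4, 4, 4]

/-- The index of the edge joining two distinct vertices. -/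
def edge (i j : Fin 5) : ℕ :=
  if i < j then j * (j - 1) / 2 + i else i * (i - 1) / 2 + j

theorem edge_src_tgt : ∀ k, edge (src k) (tgt k) = k := by decide

theorem src_ne_tgt : ∀ k, src k ≠ tgt k := by decide

theorem edge_comm : ∀ i j, edge i j = edge j i := by decide

theorem exists_edge : ∀ i j, i ≠ j →
    ∃ k : Fin 10, edge i j = k ∧ (src k = i ∧ tgt k = j ∨ src k = j ∧ tgt k = i) := by
  decide

/-- The reflexive symmetric relation on `Fin 5` whose set of edges is the set of bits of `m`. -/
def rel (m : ℕ) (i j : Fin 5) : Bool := i == j || m.testBit (edge i j)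

/-- Transitivity of `rel m`. -/
def RelTrans (m : ℕ) : Prop := ∀ i j k, rel m i j → rel m j k → rel m i k

instance (m : ℕ) : Decidable (RelTrans m) := by unfold RelTrans; infer_instance

/-- The codes of the 52 partitions of `Fin 5`. -/
def partCodes : List ℕ :=
  [0, 1, 2, 4, 7, 8, 12, 16, 18, 25, 32, 33, 42, 52, 63, 64, 68, 80, 96, 116, 128, 130, 136, 160,
    170, 193, 225, 256, 257, 264, 272, 281, 322, 338, 388, 396, 455, 512, 513, 514, 516, 519, 584,
    588, 656, 658, 729, 800, 801, 874, 948, 1023]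

theorem mem_partCodes_of_relTrans : ∀ m < 1024, RelTrans m → m ∈ partCodes := by
  decide +kernel

theorem relTrans_of_mem_partCodes : ∀ m ∈ partCodes, RelTrans m := by decide +kernel

theorem lt_of_mem_partCodes : ∀ m ∈ partCodes, m < 1024 := by decide

/-- The edge set of an equivalence relation on `Fin 5`, written as a bit vector. -/
noncomputable def code (r : Setoid (Fin 5)) : ℕ :=
  open Classical in Nat.ofBits fun k => decide (r (src k) (tgt k))

theorem rel_code (r : Setoid (Fin 5)) (i j : Fin 5) : rel (code r) i j = true ↔ r i j := by
  by_cases hij : i = j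
  · subst hij; simp [rel]
  · obtain ⟨k, hk, ⟨rfl, rfl⟩ | ⟨rfl, rfl⟩⟩ := exists_edge i j hij
    · simp [rel, hij, hk, code]
    · simp [rel, hij, hk, code, r.comm']

theorem testBit_code (r : Setoid (Fin 5)) {i j : Fin 5} (h : i ≠ j) :
    (code r).testBit (edge i j) = true ↔ r i j := by
  rw [← rel_code]; simp [rel, h]

theorem code_injective : Function.Injective code := fun r s h =>
  Setoid.ext fun i j => by rw [← rel_code, h, rel_code]

theorem code_mem_partCodes (r : Setoid (Fin 5)) : code r ∈ partCodes := by
  refine mem_partCodes_of_relTrans _ (Nat.ofBits_lt_two_pow _) fun i j k => ?_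
  simp only [rel_code]
  exact r.trans

theorem code_inf (r s : Setoid (Fin 5)) : code (r ⊓ s) = code r &&& code s := by
  refine Nat.eq_of_testBit_eq fun k => ?_
  by_cases hk : k < 10
  · simp only [code, Nat.testBit_land, Nat.testBit_ofBits_lt _ _ hk]
    rw [Bool.eq_iff_iff, Bool.and_eq_true]
    simp only [decide_eq_true_iff]
    rfl
  · simp [code, Nat.testBit_ofBits_ge _ _ (not_lt.1 hk)]

theorem code_le_iff {r s : Setoid (Fin 5)} : code r &&& code s = code r ↔ r ≤ s := by
  rw [← code_inf, code_injective.eq_iff, inf_eq_left]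

theorem exists_code_eq {m : ℕ} (hm : m ∈ partCodes) : ∃ r, code r = m := by
  refine ⟨⟨fun i j => rel m i j, fun i => by simp [rel], fun {i j} h => ?_,
    fun {i j k} => relTrans_of_mem_partCodes m hm i j k⟩, Nat.eq_of_testBit_eq fun k => ?_⟩
  · simpa only [rel, edge_comm, Bool.beq_comm] using h
  · by_cases hk : k < 10
    · simp [code, hk, rel, src_ne_tgt, edge_src_tgt]
    · rw [code, Nat.testBit_ofBits_ge _ _ (not_lt.1 hk), Nat.testBit_lt_two_pow]
      exact (lt_of_mem_partCodes m hm).trans_le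
        (Nat.pow_le_pow_right (n := 2) (by simp) (not_lt.1 hk))

/-- The bitwise conjunction of the members of `l` that contain all bits of `m`. -/
def foldJoin (m : ℕ) (l : List ℕ) : ℕ :=
  l.foldr (fun v acc => bif (m.land v).beq m then v.land acc else acc) 1023

/-- The code of the join of the partitions with codes `p` and `q`. -/
def joinCode (p q : ℕ) : ℕ := foldJoin (p ||| q) partCodes

theorem foldJoin_cons (m v : ℕ) (l : List ℕ) : foldJoin m (v :: l) =
    if m &&& v = m then v &&& foldJoin m l else foldJoin m l := by
  change (bif (m &&& v).beq m then v &&& foldJoin m l else foldJoin m l) = _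
  rw [Bool.cond_eq_ite]
  simp only [Nat.beq_eq]

theorem land_lor_self (m n : ℕ) : m &&& (m ||| n) = m :=
  Nat.eq_of_testBit_eq fun i => by
    rw [Nat.testBit_land, Nat.testBit_lor]
    cases m.testBit i <;> rfl

theorem and_1023_of_mem_partCodes : ∀ m ∈ partCodes, m &&& 1023 = m := by decide

theorem code_sup (r s : Setoid (Fin 5)) : code (r ⊔ s) = joinCode (code r) (code s) := by
  have least : ∀ v ∈ partCodes, (code r ||| code s) &&& v = code r ||| code s →
      code (r ⊔ s) &&& v = code (r ⊔ s) := by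
    intro v hv h
    obtain ⟨t, rfl⟩ := exists_code_eq hv
    rw [code_le_iff]
    refine sup_le (code_le_iff.1 ?_) (code_le_iff.1 ?_)
    · calc code r &&& code t = code r &&& ((code r ||| code s) &&& code t) := by
            rw [← Nat.and_assoc, land_lor_self]
        _ = code r := by rw [h, land_lor_self]
    · calc code s &&& code t = code s &&& ((code r ||| code s) &&& code t) := by
            rw [← Nat.and_assoc, Nat.or_comm, land_lor_self]
        _ = code s := by rw [h, Nat.or_comm, land_lor_self]
  have upper : (code r ||| code s) &&& code (r ⊔ s) = code r ||| code s := by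
    rw [Nat.and_comm, Nat.and_or_distrib_left, Nat.and_comm, code_le_iff.2 le_sup_left,
      Nat.and_comm, code_le_iff.2 le_sup_right]
  have below : ∀ l ⊆ partCodes, code (r ⊔ s) &&& foldJoin (code r ||| code s) l = code (r ⊔ s) := by
    intro l
    induction l with
    | nil => exact fun _ => and_1023_of_mem_partCodes _ (code_mem_partCodes _)
    | cons v l ih =>
      intro hl
      rw [List.cons_subset] at hl
      rw [foldJoin_cons]
      split_ifs with h
      · rw [← Nat.and_assoc, least v hl.1 h, ih hl.2]
      · exact ih hl.2
  have above : ∀ l, code (r ⊔ s) ∈ l →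
      foldJoin (code r ||| code s) l &&& code (r ⊔ s) = foldJoin (code r ||| code s) l := by
    intro l hl
    induction l with
    | nil => simp at hl
    | cons v l ih =>
      rw [foldJoin_cons]
      rcases List.mem_cons.1 hl with rfl | hl
      · rw [if_pos upper, Nat.and_comm, ← Nat.and_assoc, Nat.and_self]
      · split_ifs
        · rw [Nat.and_assoc, ih hl]
        · exact ih hl
  rw [joinCode, ← above _ (code_mem_partCodes _), Nat.and_comm, below _ (List.Subset.refl _)]

/-- The number whose binary digits are the parities of the values of `g` on `l`. -/
def pack {α : Type*} (g : α → ℕ) (l : List α) : ℕ := l.foldr (fun t acc => g t % 2 + 2 * acc) 0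

theorem testBit_pack {α : Type*} (g : α → ℕ) (l : List α) (i : ℕ) :
    (pack g l).testBit i = l[i]?.any fun t => (g t).testBit 0 := by
  induction l generalizing i with
  | nil => simp [pack]
  | cons t l ih =>
    rw [pack, List.foldr_cons, ← pack]
    cases i with
    | zero => simp [Nat.testBit_zero, Nat.add_mod]
    | succ i =>
      rw [Nat.testBit_succ, List.getElem?_cons_succ, ← ih]
      congr 1
      omega

/-- The action of a permutation on edges, as a list of powers of two. -/
def edgeMap (σ : Equiv.Perm (Fin 5)) : List ℕ :=
  List.ofFn fun k => 2 ^ edge (σ (src k)) (σ (tgt k))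

/-- The code of the pullback of the partition with code `m` along a permutation with edge
map `e`. -/
def pull (e : List ℕ) (m : ℕ) : ℕ := pack (fun j => m / j) e

theorem code_comap (σ : Equiv.Perm (Fin 5)) (r : Setoid (Fin 5)) :
    code (r.comap σ) = pull (edgeMap σ) (code r) := by
  refine Nat.eq_of_testBit_eq fun k => ?_
  rw [pull, testBit_pack, edgeMap, List.getElem?_ofFn]
  by_cases hk : k < 10
  · rw [dif_pos hk, Option.any_some, Nat.testBit_div_two_pow, zero_add, Bool.eq_iff_iff,
      testBit_code r (σ.injective.ne (src_ne_tgt ⟨k, hk⟩)), code, Nat.testBit_ofBits_lt _ _ hk,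
      @decide_eq_true_iff _ (_)]
    rfl
  · rw [dif_neg hk, code, Nat.testBit_ofBits_ge _ _ (not_lt.1 hk), Option.any_none]

/-- Pulling back equivalence relations along a permutation. -/
def comapIso {α : Type*} (σ : Equiv.Perm α) : Setoid α ≃o Setoid α where
  toFun r := r.comap σ
  invFun r := r.comap σ.symm
  left_inv r := Setoid.ext fun i j => by simp [Setoid.comap_rel]
  right_inv r := Setoid.ext fun i j => by simp [Setoid.comap_rel]
  map_rel_iff' {r s} := by
    refine ⟨fun h i j hij => ?_, fun h i j hij => h hij⟩
    have key : r (σ (σ.symm i)) (σ (σ.symm j)) → s (σ (σ.symm i)) (σ (σ.symm j)) := fun h' => h h'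
    simp only [Equiv.apply_symm_apply] at key
    exact key hij

/-- Representatives, as lists of codes, of six conjugacy classes of proper sublattices of the
partition lattice of `Fin 5`. -/
def baseCodes : List (List ℕ) :=
  [[0, 1, 12, 18, 32, 33, 63, 96, 160, 225, 257, 513, 801, 1023],
    [0, 1, 2, 4, 7, 8, 12, 25, 42, 63, 68, 130, 170, 257, 281, 455, 516, 519, 588, 1023],
    [0, 1, 2, 7, 8, 25, 32, 33, 42, 63, 128, 130, 136, 160, 170, 193, 225, 257, 281, 455, 513, 519,
      729, 801, 1023],
    [0, 1, 2, 4, 7, 12, 18, 33, 63, 68, 130, 257, 455, 512, 513, 514, 516, 519, 588, 658, 801,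
      1023],
    [0, 1, 2, 4, 7, 8, 12, 25, 42, 63, 128, 130, 136, 170, 193, 388, 396, 455, 513, 519, 729, 1023],
    [0, 1, 2, 4, 7, 8, 12, 25, 42, 63, 64, 68, 193, 322, 455, 512, 513, 514, 516, 519, 584, 588,
      729, 874, 1023]]

theorem baseCodes_closed : ∀ S ∈ baseCodes, ∀ p ∈ S, ∀ q ∈ S, p &&& q ∈ S ∧ joinCode p q ∈ S := by
  decide +kernel

theorem baseCodes_proper : ∀ S ∈ baseCodes, ∃ p ∈ partCodes, p ∉ S := by decide +kernel

/-- The bit vector of a finite set of natural numbers. -/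
def bits (S : List ℕ) : ℕ := S.foldr (fun s acc => 1 <<< s ||| acc) 0

theorem testBit_bits (S : List ℕ) (m : ℕ) : (bits S).testBit m = true ↔ m ∈ S := by
  induction S with
  | nil => simp [bits]
  | cons s S ih =>
    rw [bits, List.foldr_cons, ← bits, Nat.testBit_lor, Bool.or_eq_true, ih, List.mem_cons,
      Nat.one_shiftLeft, Nat.testBit_two_pow, decide_eq_true_iff, eq_comm]

/-- All permutations of `Fin 5`. -/
def perms : List (Equiv.Perm (Fin 5)) :=
  ([0, 1, 2, 3, 4] : List (Fin 5)).flatMap fun a => ([1, 2, 3, 4] : List (Fin 5)).flatMap fun b =>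
  ([2, 3, 4] : List (Fin 5)).flatMap fun c => ([3, 4] : List (Fin 5)).map fun d =>
  Equiv.swap 0 a * Equiv.swap 1 b * Equiv.swap 2 c * Equiv.swap 3 d

/-- Edge maps of permutations paired with bit vectors of the members of `baseCodes`. -/
def conjugates : List (List ℕ × ℕ) :=
  perms.flatMap fun σ => baseCodes.map fun S => (edgeMap σ, bits S)

/-- The set of those members of `conjugates` whose sublattice contains the partition with
code `m`. -/
def mask (m : ℕ) : ℕ := pack (fun t => t.2 / 2 ^ pull t.1 m) conjugates

/-- The codes of one partition of each type. -/
def typeCodes : List ℕ := [0, 1, 7, 33, 63, 519, 1023]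

theorem exists_pull_mem_typeCodes :
    ∀ a ∈ partCodes, ∃ σ ∈ perms, pull (edgeMap σ) a ∈ typeCodes := by
  decide +kernel

theorem mask_pairwise : ∀ a ∈ typeCodes, ∀ b ∈ partCodes, a.land b = a → a ≠ b →
    (partCodes.map mask).Pairwise fun x y =>
      Nat.blt 0 ((((mask a).land (mask b)).land x).land y) := by
  decide +kernel

/-- The set of partitions whose pullback along `σ` has its code in `S`. -/
def conjugate (σ : Equiv.Perm (Fin 5)) (S : List ℕ) : Set (Setoid (Fin 5)) :=
  {r | code (r.comap σ) ∈ S}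

theorem isSublattice_conjugate (σ : Equiv.Perm (Fin 5)) {S : List ℕ} (hS : S ∈ baseCodes) :
    IsSublattice (conjugate σ S) where
  supClosed r hr s hs := by
    change code (comapIso σ (r ⊔ s)) ∈ S
    rw [map_sup, code_sup]
    exact (baseCodes_closed S hS _ hr _ hs).2
  infClosed r hr s hs := by
    change code (comapIso σ (r ⊓ s)) ∈ S
    rw [map_inf, code_inf]
    exact (baseCodes_closed S hS _ hr _ hs).1

theorem conjugate_ne_univ (σ : Equiv.Perm (Fin 5)) {S : List ℕ} (hS : S ∈ baseCodes) :
    conjugate σ S ≠ Set.univ := by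
  obtain ⟨p, hp, hpS⟩ := baseCodes_proper S hS
  obtain ⟨r, rfl⟩ := exists_code_eq hp
  refine (Set.ne_univ_iff_exists_notMem _).2 ⟨(comapIso σ).symm r, fun h => hpS ?_⟩
  change code (comapIso σ ((comapIso σ).symm r)) ∈ S at h
  rwa [OrderIso.apply_symm_apply] at h

theorem testBit_mask (r : Setoid (Fin 5)) (i : ℕ) :
    (mask (code r)).testBit i = conjugates[i]?.any fun t => t.2.testBit (pull t.1 (code r)) := by
  simp only [mask, testBit_pack, Nat.testBit_div_two_pow, zero_add]

theorem exists_conjugate_of_mask {a b c d : Setoid (Fin 5)}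
    (h : mask (code a) &&& mask (code b) &&& mask (code c) &&& mask (code d) ≠ 0) :
    ∃ σ, ∃ S ∈ baseCodes, a ∈ conjugate σ S ∧ b ∈ conjugate σ S ∧ c ∈ conjugate σ S ∧
      d ∈ conjugate σ S := by
  obtain ⟨i, hi⟩ := Nat.exists_testBit_of_ne_zero h
  simp only [Nat.testBit_land, testBit_mask, Bool.and_eq_true] at hi
  cases ht : conjugates[i]? with
  | none => simp [ht] at hi
  | some t =>
    obtain ⟨σ, -, S, hS, rfl⟩ : ∃ σ ∈ perms, ∃ S ∈ baseCodes, (edgeMap σ, bits S) = t := by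
      simpa [conjugates] using List.mem_of_getElem? ht
    simp only [ht, Option.any_some, testBit_bits, ← code_comap] at hi
    exact ⟨σ, S, hS, hi.1.1.1, hi.1.1.2, hi.1.2, hi.2⟩

theorem exists_proper_sublattice {a b c d : Setoid (Fin 5)} (hab : a < b) (hcd : c ≠ d) :
    ∃ T : Set (Setoid (Fin 5)), IsSublattice T ∧ T ≠ Set.univ ∧ a ∈ T ∧ b ∈ T ∧ c ∈ T ∧ d ∈ T := by
  obtain ⟨τ, -, hτ⟩ := exists_pull_mem_typeCodes _ (code_mem_partCodes a)
  rw [← code_comap] at hτ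
  have hlt : comapIso τ a < comapIso τ b := (comapIso τ).lt_iff_lt.2 hab
  have key := List.pairwise_map.1 (mask_pairwise _ hτ _ (code_mem_partCodes (comapIso τ b))
    (code_le_iff.2 hlt.le) (code_injective.ne hlt.ne))
  let R (x y : ℕ) : Prop :=
    mask (code (comapIso τ a)) &&& mask (code (comapIso τ b)) &&& mask x &&& mask y ≠ 0
  have : Std.Symm R :=
    ⟨fun x y h => by
      simpa only [R, Nat.and_assoc _ (mask x), Nat.and_assoc _ (mask y),
        Nat.and_comm (mask y) (mask x)] using h⟩
  have hR : partCodes.Pairwise R := key.imp fun h => Nat.ne_of_gt (Nat.blt_eq.mp h)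
  have hne := hR.forall (code_mem_partCodes (comapIso τ c)) (code_mem_partCodes (comapIso τ d))
    (code_injective.ne ((comapIso τ).injective.ne hcd))
  obtain ⟨σ, S, hS, ha, hb, hc, hd⟩ := exists_conjugate_of_mask hne
  refine ⟨conjugate (τ * σ) S, isSublattice_conjugate _ hS, conjugate_ne_univ _ hS, ha, hb, hc, hd⟩

end PartitionLattice

/-- Every four-element generating set of the partition lattice
`Part(5) = Setoid (Fin 5)` is an antichain (no two distinct members are comparable);
consequently `Part(5)` has no `(1+1+2)`-generating set. -/
theorem part5_generating_sets_are_antichains (X : Finset (Setoid (Fin 5)))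
    (hcard : X.card = 4)
    (hgen : latticeClosure (X : Set (Setoid (Fin 5))) = Set.univ) :
    IsAntichain (· ≤ ·) (X : Set (Setoid (Fin 5))) := by
  classical
  by_contra hanti
  obtain ⟨a, ha, b, hb, hne, hle⟩ : ∃ a ∈ X, ∃ b ∈ X, a ≠ b ∧ a ≤ b := by
    simpa [IsAntichain, Set.Pairwise] using hanti
  have hb' : b ∈ X.erase a := Finset.mem_erase.2 ⟨hne.symm, hb⟩
  obtain ⟨c, d, hcd, hX⟩ : ∃ c d, c ≠ d ∧ (X.erase a).erase b = {c, d} := by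
    rw [← Finset.card_eq_two, Finset.card_erase_of_mem hb', Finset.card_erase_of_mem ha, hcard]
  obtain ⟨T, hT, hTne, haT, hbT, hcT, hdT⟩ :=
    PartitionLattice.exists_proper_sublattice (lt_of_le_of_ne hle hne) hcd
  refine hTne (Set.univ_subset_iff.1 (hgen ▸ latticeClosure_min ?_ hT))
  intro x hx
  by_cases hxa : x = a
  · exact hxa ▸ haT
  by_cases hxb : x = b
  · exact hxb ▸ hbT
  have hx' : x ∈ ({c, d} : Finset (Setoid (Fin 5))) :=
    hX ▸ Finset.mem_erase.2 ⟨hxb, Finset.mem_erase.2 ⟨hxa, hx⟩⟩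
  rcases Finset.mem_insert.1 hx' with rfl | h
  · exact hcT
  · exact Finset.mem_singleton.1 h ▸ hdT
end

section
/- Even case of the configuration with a nontrivial necktie: Let k ≥ 2 be an integer, let m = 2k−3, and let A be a set consisting of 2k+2 pairwise distinct elements a_0, a_1, …, a_k, b_0, b_1, …, b_{k−1}, c. Let s and t be integers with 0 ≤ s < t ≤ k−1. Define the edges I_0, I_1, …, I_{m+1} by I_{2j} = (a_j, a_{j+1}) for 0 ≤ j ≤ k−1 and I_{2j+1} = (b_j, b_{j+1}) for 0 ≤ j ≤ k−2, and write equ(I_r) for the atom of Equ(A) collapsing the two endpoints of I_r. Let Z be an arbitrary subset of {1,…,m}. Define α = (⋁_{j=0}^{k−1} equ(a_j, a_{j+1})) ⊔ (⋁_{j=0}^{k−2} equ(b_j, b_{j+1})), β = equ(b_s, c) ⊔ (⋁_{i=0}^{k−1} equ(a_i, b_i)), γ = equ(b_t, c) ⊔ (⋁_{i=0}^{k−1} equ(a_{i+1}, b_i)), and δ = equ(a_0, b_0) ⊔ equ(a_k, b_{k−1}) ⊔ (⋁_{i ∈ Z} equ(I_i)). Then the four-element set {α, β, γ, δ} generates the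 lattice Equ(A). -/
/-- The least equivalence relation on `A` identifying `u` and `v`
(its only nonsingleton block is `{u, v}`; it is `⊥` when `u = v`). -/
def equ {A : Type*} (u v : A) : Setoid A := sInf {s : Setoid A | s u v}

section Equ

variable {A : Type*}

lemma equ_le_iff {u v : A} {r : Setoid A} : equ u v ≤ r ↔ r u v :=
  ⟨fun h => h fun _ hs => hs, fun h => sInf_le h⟩

lemma equ_rel (u v : A) : equ u v u v := equ_le_iff.1 le_rfl

lemma equ_comm (u v : A) : equ u v = equ v u :=
  le_antisymm (equ_le_iff.2 ((equ v u).symm (equ_rel v u)))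
    (equ_le_iff.2 ((equ u v).symm (equ_rel u v)))

lemma equ_self (u : A) : equ u u = ⊥ := le_bot_iff.1 (equ_le_iff.2 ((⊥ : Setoid A).refl u))

lemma eq_equ_of_forall {u v : A} {r : Setoid A} (huv : r u v)
    (h : ∀ x y, r x y → x = y ∨ (x = u ∧ y = v) ∨ (x = v ∧ y = u)) : r = equ u v := by
  refine le_antisymm (fun {x y} hxy => ?_) (equ_le_iff.2 huv)
  rcases h x y hxy with rfl | ⟨rfl, rfl⟩ | ⟨rfl, rfl⟩
  · exact (equ u v).refl x
  · exact equ_rel x y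
  · exact (equ y x).symm (equ_rel y x)

/-- The equivalence relation whose only possibly nonsingleton block is `s`. -/
def collapse (s : Set A) : Setoid A where
  r x y := x = y ∨ (x ∈ s ∧ y ∈ s)
  iseqv := ⟨fun _ => Or.inl rfl, by grind, by grind⟩

lemma collapse_rel {s : Set A} {x y : A} : collapse s x y ↔ x = y ∨ (x ∈ s ∧ y ∈ s) := Iff.rfl

lemma equ_sup_equ_le_collapse (x y z : A) : equ x y ⊔ equ y z ≤ collapse {x, y, z} :=
  sup_le (equ_le_iff.2 (collapse_rel.2 (by simp))) (equ_le_iff.2 (collapse_rel.2 (by simp)))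

lemma rel_trans {r : Setoid A} {x y z : A} (h : r x y) (h' : r y z) : r x z := r.trans h h'

lemma rel_symm {r : Setoid A} {x y : A} (h : r x y) : r y x := r.symm h

variable {L : Set (Setoid A)}

lemma equ_mem_of_triangle (hL : IsSublattice L) {r : Setoid A} (hr : r ∈ L) {x y z : A}
    (hxy : equ x y ∈ L) (hyz : equ y z ∈ L) (hrxz : r x z) (hrxy : ¬ r x y) : equ x z ∈ L := by
  have hryz : ¬ r y z := fun h => hrxy (rel_trans hrxz (rel_symm h))
  rw [← eq_equ_of_forall (r := r ⊓ (equ x y ⊔ equ y z))]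
  · exact hL.2 hr (hL.1 hxy hyz)
  · exact ⟨hrxz, rel_trans (le_sup_left (a := equ x y) (equ_rel x y))
      (le_sup_right (b := equ y z) (equ_rel y z))⟩
  · rintro p q ⟨hpq, hpq'⟩
    have hqp := rel_symm hpq
    rcases equ_sup_equ_le_collapse x y z hpq' with h | ⟨hp, hq⟩
    · exact Or.inl h
    · have hryx : ¬ r y x := fun h => hrxy (rel_symm h)
      have hrzy : ¬ r z y := fun h => hryz (rel_symm h)
      rcases hp with rfl | rfl | rfl <;> rcases hq with rfl | rfl | rfl <;> simp_all

lemma equ_mem_of_square (hL : IsSublattice L) {x y z w : A} (hxy : equ x y ∈ L)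
    (hyz : equ y z ∈ L) (hxw : equ x w ∈ L) (hwz : equ w z ∈ L) (hyw : y ≠ w) :
    equ x z ∈ L := by
  by_cases hx : x = y
  · rwa [hx]
  by_cases hz : y = z
  · rwa [← hz]
  refine equ_mem_of_triangle hL (hL.1 hxw hwz) hxy hyz
    (rel_trans (le_sup_left (a := equ x w) (equ_rel x w))
      (le_sup_right (b := equ w z) (equ_rel w z))) fun h => ?_
  rcases equ_sup_equ_le_collapse x w z h with h | ⟨-, h | h | h⟩
  · exact hx h
  · exact hx h.symm
  · exact hyw h
  · exact hz h

lemma equ_mem_of_path (hL : IsSublattice L) (h0 : ⊥ ∈ L) {v : ℕ → A} {N : ℕ}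
    (hv : ∀ n < N, v n ≠ v (n + 1)) (h1 : ∀ n, n + 1 ≤ N → equ (v n) (v (n + 1)) ∈ L)
    (h2 : ∀ n, n + 2 ≤ N → equ (v n) (v (n + 2)) ∈ L) (d n : ℕ) (hn : n + d ≤ N) :
    equ (v n) (v (n + d)) ∈ L := by
  induction d using Nat.strong_induction_on generalizing n with
  | _ d ih =>
    match d, ih, hn with
    | 0, _, _ => simpa [equ_self] using h0
    | 1, _, hn => exact h1 n hn
    | 2, _, hn => exact h2 n hn
    | d + 3, ih, hn =>
      have e1 := ih (d + 2) (by omega) (n + 1) (by omega)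
      have e2 := ih (d + 1) (by omega) (n + 2) (by omega)
      rw [show n + 1 + (d + 2) = n + (d + 3) by omega] at e1
      rw [show n + 2 + (d + 1) = n + (d + 3) by omega] at e2
      exact equ_mem_of_square hL (h1 n (by omega)) e1 (h2 n (by omega)) e2 (hv (n + 1) (by omega))

lemma eq_univ_of_forall_equ_mem [Finite A] [Nonempty A] (hL : IsSublattice L)
    (h : ∀ x y, equ x y ∈ L) : L = Set.univ := by
  classical
  have := Fintype.ofFinite A
  have h0 : ⊥ ∈ L := equ_self (Classical.arbitrary A) ▸ h _ _
  refine Set.eq_univ_of_forall fun r => ?_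
  have hr : r = Finset.univ.sup fun p : A × A => if r p.1 p.2 then equ p.1 p.2 else ⊥ := by
    refine le_antisymm (fun {x y} hxy => ?_) (Finset.sup_le fun p _ => ?_)
    · have hle := Finset.le_sup (f := fun p : A × A => if r p.1 p.2 then equ p.1 p.2 else ⊥)
        (Finset.mem_univ (x, y))
      rw [if_pos hxy] at hle
      exact hle (equ_rel x y)
    · split_ifs with hp
      · exact equ_le_iff.2 hp
      · exact bot_le
  rw [hr]
  refine Finset.sup_induction (p := (· ∈ L)) h0 (fun _ h1 _ h2 => hL.1 h1 h2) fun p _ => ?_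
  split_ifs
  · exact h _ _
  · exact h0

end Equ

/-- The set `A` consists of the pairwise distinct elements
`a 0, …, a k, b 0, …, b (k - 1), c`. -/
structure IsConfiguration {A : Type*} (k : ℕ) (a b : ℕ → A) (c : A) : Prop where
  a_inj : ∀ i ≤ k, ∀ j ≤ k, a i = a j → i = j
  b_inj : ∀ i < k, ∀ j < k, b i = b j → i = j
  a_ne_b : ∀ i ≤ k, ∀ j < k, a i ≠ b j
  a_ne_c : ∀ i ≤ k, a i ≠ c
  b_ne_c : ∀ j < k, b j ≠ c
  cover : ∀ x : A, (∃ i ≤ k, x = a i) ∨ (∃ j < k, x = b j) ∨ x = c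

open Classical in
/-- The function with values `f i` at `a i`, `g j` at `b j`, and `n` elsewhere. -/
noncomputable def label {A : Type*} (k : ℕ) (a b : ℕ → A) (f g : ℕ → ℕ) (n : ℕ) (x : A) : ℕ :=
  if h : ∃ i ≤ k, x = a i then f h.choose
  else if h : ∃ j < k, x = b j then g h.choose else n

/-- `r` relates consecutive elements among `a 0, …, a p` and among `b 0, …, b q`, and
every pair it relates lies inside one of these two initial segments or is trivial. -/
structure IsInitial {A : Type*} (k : ℕ) (a b : ℕ → A) (r : Setoid A) (p q : ℕ) : Prop where
  rel_a : ∀ i < p, r (a i) (a (i + 1))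
  rel_b : ∀ i < q, r (b i) (b (i + 1))
  le_ker : r ≤ Setoid.ker (label k a b (fun i => 2 * max i p + 1) (fun i => 2 * max i q + 2) 0)

namespace IsConfiguration

variable {A : Type*} {k : ℕ} {a b : ℕ → A} {c : A}

lemma label_a (C : IsConfiguration k a b c) (f g : ℕ → ℕ) (n : ℕ) {i : ℕ} (hi : i ≤ k) :
    label k a b f g n (a i) = f i := by
  have h : ∃ j ≤ k, a i = a j := ⟨i, hi, rfl⟩
  rw [label, dif_pos h, ← C.a_inj i hi _ h.choose_spec.1 h.choose_spec.2]

lemma label_b (C : IsConfiguration k a b c) (f g : ℕ → ℕ) (n : ℕ) {i : ℕ} (hi : i < k) :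
    label k a b f g n (b i) = g i := by
  have h' : ¬ ∃ j ≤ k, b i = a j := fun ⟨j, hj, h⟩ => C.a_ne_b j hj i hi h.symm
  have h : ∃ j < k, b i = b j := ⟨i, hi, rfl⟩
  rw [label, dif_neg h', dif_pos h, ← C.b_inj i hi _ h.choose_spec.1 h.choose_spec.2]

lemma label_c (C : IsConfiguration k a b c) (f g : ℕ → ℕ) (n : ℕ) : label k a b f g n c = n := by
  have h' : ¬ ∃ j ≤ k, c = a j := fun ⟨j, hj, h⟩ => C.a_ne_c j hj h.symm
  have h : ¬ ∃ j < k, c = b j := fun ⟨j, hj, h⟩ => C.b_ne_c j hj h.symm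
  rw [label, dif_neg h', dif_neg h]

lemma finite (C : IsConfiguration k a b c) : Finite A := by
  refine Set.finite_univ_iff.1 (((((Set.finite_Iic k).image a).union
    ((Set.finite_Iio k).image b)).union (Set.finite_singleton c)).subset fun x _ => ?_)
  rcases C.cover x with ⟨i, hi, rfl⟩ | ⟨i, hi, rfl⟩ | rfl
  · exact Or.inl (Or.inl ⟨i, hi, rfl⟩)
  · exact Or.inl (Or.inr ⟨i, hi, rfl⟩)
  · exact Or.inr rfl

lemma reverse (C : IsConfiguration k a b c) :
    IsConfiguration k (fun i => a (k - i)) (fun i => b (k - 1 - i)) c where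
  a_inj i hi j hj h := by have := C.a_inj _ (by omega) _ (by omega) h; omega
  b_inj i hi j hj h := by have := C.b_inj _ (by omega) _ (by omega) h; omega
  a_ne_b i _ j _ := C.a_ne_b _ (by omega) _ (by omega)
  a_ne_c i _ := C.a_ne_c _ (by omega)
  b_ne_c j _ := C.b_ne_c _ (by omega)
  cover x := by
    rcases C.cover x with ⟨i, hi, rfl⟩ | ⟨i, hi, rfl⟩ | rfl
    · exact Or.inl ⟨k - i, by omega, by congr 1; omega⟩
    · exact Or.inr (Or.inl ⟨k - 1 - i, by omega, by congr 1; omega⟩)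
    · exact Or.inr (Or.inr rfl)

lemma label_reverse (C : IsConfiguration k a b c) (f g : ℕ → ℕ) (n : ℕ) :
    label k (fun i => a (k - i)) (fun i => b (k - 1 - i)) f g n =
      label k a b (fun i => f (k - i)) (fun i => g (k - 1 - i)) n := by
  funext x
  rcases C.reverse.cover x with ⟨i, hi, rfl⟩ | ⟨i, hi, rfl⟩ | rfl
  · rw [C.reverse.label_a f g n hi, C.label_a _ _ _ (by omega)]
    congr 1; omega
  · rw [C.reverse.label_b f g n hi, C.label_b _ _ _ (by omega)]
    congr 1; omega
  · rw [C.reverse.label_c, C.label_c]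

/-- Coarsening of labellings, checked on codes. -/
lemma le_ker_label (C : IsConfiguration k a b c) {r : Setoid A} {f g f₁ g₁ f₂ g₂ : ℕ → ℕ}
    {n n₁ n₂ : ℕ} (h₁ : r ≤ Setoid.ker (label k a b f₁ g₁ n₁))
    (h₂ : r ≤ Setoid.ker (label k a b f₂ g₂ n₂))
    (haa : ∀ i ≤ k, ∀ j ≤ k, f₁ i = f₁ j → f₂ i = f₂ j → f i = f j)
    (hbb : ∀ i < k, ∀ j < k, g₁ i = g₁ j → g₂ i = g₂ j → g i = g j)
    (hab : ∀ i ≤ k, ∀ j < k, f₁ i = g₁ j → f₂ i = g₂ j → f i = g j)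
    (hac : ∀ i ≤ k, f₁ i = n₁ → f₂ i = n₂ → f i = n)
    (hbc : ∀ j < k, g₁ j = n₁ → g₂ j = n₂ → g j = n) :
    r ≤ Setoid.ker (label k a b f g n) := by
  intro x y hxy
  have e₁ : label k a b f₁ g₁ n₁ x = label k a b f₁ g₁ n₁ y := h₁ hxy
  have e₂ : label k a b f₂ g₂ n₂ x = label k a b f₂ g₂ n₂ y := h₂ hxy
  change label k a b f g n x = label k a b f g n y
  rcases C.cover x with ⟨i, hi, rfl⟩ | ⟨i, hi, rfl⟩ | rfl <;>
    rcases C.cover y with ⟨j, hj, rfl⟩ | ⟨j, hj, rfl⟩ | rfl <;>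
    simp (disch := assumption) only [C.label_a, C.label_b, C.label_c] at e₁ e₂ ⊢ <;> grind

/-- A relation which respects a labelling separating all pairs but `(u, v)` is `equ u v`. -/
lemma eq_equ (C : IsConfiguration k a b c) {r : Setoid A} {u v : A} {f₁ g₁ f₂ g₂ : ℕ → ℕ}
    {n₁ n₂ : ℕ} (huv : r u v) (h₁ : r ≤ Setoid.ker (label k a b f₁ g₁ n₁))
    (h₂ : r ≤ Setoid.ker (label k a b f₂ g₂ n₂))
    (haa : ∀ i ≤ k, ∀ j ≤ k, i < j → f₁ i = f₁ j → f₂ i = f₂ j → a i = u ∧ a j = v)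
    (hbb : ∀ i < k, ∀ j < k, i < j → g₁ i = g₁ j → g₂ i = g₂ j → b i = u ∧ b j = v)
    (hab : ∀ i ≤ k, ∀ j < k, f₁ i = g₁ j → f₂ i = g₂ j → a i = u ∧ b j = v)
    (hac : ∀ i ≤ k, f₁ i = n₁ → f₂ i = n₂ → a i = u ∧ c = v)
    (hbc : ∀ j < k, g₁ j = n₁ → g₂ j = n₂ → b j = u ∧ c = v) :
    r = equ u v := by
  refine eq_equ_of_forall huv fun x y hxy => ?_
  have e₁ : label k a b f₁ g₁ n₁ x = label k a b f₁ g₁ n₁ y := h₁ hxy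
  have e₂ : label k a b f₂ g₂ n₂ x = label k a b f₂ g₂ n₂ y := h₂ hxy
  rcases C.cover x with ⟨i, hi, rfl⟩ | ⟨i, hi, rfl⟩ | rfl <;>
    rcases C.cover y with ⟨j, hj, rfl⟩ | ⟨j, hj, rfl⟩ | rfl <;>
    simp (disch := assumption) only [C.label_a, C.label_b, C.label_c] at e₁ e₂
  · rcases lt_trichotomy i j with h | rfl | h <;> grind
  · grind
  · grind
  · grind
  · rcases lt_trichotomy i j with h | rfl | h <;> grind
  · grind
  · grind
  · grind
  · exact Or.inl rfl

variable {L : Set (Setoid A)} {α β γ : Setoid A} {s t : ℕ}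

lemma exists_isInitial_one (C : IsConfiguration k a b c) (hL : IsSublattice L)
    (hα : α ∈ L) (hγ : γ ∈ L) (hk : 0 < k)
    (hαa : ∀ i < k, α (a i) (a (i + 1)))
    (hα' : α ≤ Setoid.ker (label k a b (fun _ => 0) (fun _ => 1) 2))
    (hγab : ∀ i < k, γ (a (i + 1)) (b i))
    (hγ' : γ ≤ Setoid.ker (label k a b (fun i => i) (fun i => i + 1) (t + 1)))
    (h0 : equ (a 0) (b 0) ∈ L) : ∃ r ∈ L, IsInitial k a b r 1 0 := by
  refine ⟨(equ (a 0) (b 0) ⊔ γ) ⊓ α, hL.2 (hL.1 h0 hγ) hα, ?_, by simp, ?_⟩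
  · intro i hi
    obtain rfl : i = 0 := by omega
    exact ⟨rel_trans (le_sup_left (a := equ (a 0) (b 0)) (equ_rel _ _))
      (le_sup_right (b := γ) (rel_symm (hγab 0 hk))), hαa 0 hk⟩
  · have h : equ (a 0) (b 0) ⊔ γ ≤ Setoid.ker
        (label k a b (fun i => max i 1) (fun i => max (i + 1) 1) (max (t + 1) 1)) := by
      refine sup_le (equ_le_iff.2 ?_) (C.le_ker_label hγ' hγ' ?_ ?_ ?_ ?_ ?_)
      · simp only [Setoid.ker_def]
        rw [C.label_a _ _ _ (by omega), C.label_b _ _ _ hk]; rfl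
      all_goals grind
    exact C.le_ker_label (inf_le_of_left_le h) (inf_le_of_right_le hα')
      (by grind) (by grind) (by grind) (by grind) (by grind)

lemma exists_isInitial_succ_right (C : IsConfiguration k a b c) (hL : IsSublattice L)
    (hα : α ∈ L) (hβ : β ∈ L) (hαa : ∀ i < k, α (a i) (a (i + 1)))
    (hαb : ∀ i, i + 1 < k → α (b i) (b (i + 1)))
    (hα' : α ≤ Setoid.ker (label k a b (fun _ => 0) (fun _ => 1) 2))
    (hβab : ∀ i < k, β (a i) (b i))
    (hβ' : β ≤ Setoid.ker (label k a b (fun i => i) (fun i => i) s)) {j : ℕ} (hj : j + 1 < k)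
    (h : ∃ r ∈ L, IsInitial k a b r (j + 1) j) :
    ∃ r ∈ L, IsInitial k a b r (j + 1) (j + 1) := by
  obtain ⟨r, hr, hra, hrb, hr'⟩ := h
  refine ⟨(r ⊔ β) ⊓ α, hL.2 (hL.1 hr hβ) hα, ?_, ?_, ?_⟩
  · exact fun i hi => ⟨le_sup_left (a := r) (hra i hi), hαa i (by omega)⟩
  · intro i hi
    refine ⟨?_, hαb i (by omega)⟩
    rcases Nat.lt_succ_iff_lt_or_eq.1 hi with hi | rfl
    · exact le_sup_left (a := r) (hrb i hi)
    · exact rel_trans (le_sup_right (b := β) (rel_symm (hβab i (by omega))))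
        (rel_trans (le_sup_left (a := r) (hra i hi))
          (le_sup_right (b := β) (hβab (i + 1) (by omega))))
  · have h : r ⊔ β ≤ Setoid.ker
        (label k a b (fun i => max i (j + 1)) (fun i => max i (j + 1)) (max s (j + 1))) :=
      sup_le (C.le_ker_label hr' hr' (by grind) (by grind) (by grind) (by grind) (by grind))
        (C.le_ker_label hβ' hβ' (by grind) (by grind) (by grind) (by grind) (by grind))
    exact C.le_ker_label (inf_le_of_left_le h) (inf_le_of_right_le hα')
      (by grind) (by grind) (by grind) (by grind) (by grind)

lemma exists_isInitial_succ_left (C : IsConfiguration k a b c) (hL : IsSublattice L)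
    (hα : α ∈ L) (hγ : γ ∈ L) (hαa : ∀ i < k, α (a i) (a (i + 1)))
    (hαb : ∀ i, i + 1 < k → α (b i) (b (i + 1)))
    (hα' : α ≤ Setoid.ker (label k a b (fun _ => 0) (fun _ => 1) 2))
    (hγab : ∀ i < k, γ (a (i + 1)) (b i))
    (hγ' : γ ≤ Setoid.ker (label k a b (fun i => i) (fun i => i + 1) (t + 1))) {j : ℕ}
    (hj : j + 1 < k) (h : ∃ r ∈ L, IsInitial k a b r (j + 1) (j + 1)) :
    ∃ r ∈ L, IsInitial k a b r (j + 2) (j + 1) := by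
  obtain ⟨r, hr, hra, hrb, hr'⟩ := h
  refine ⟨(r ⊔ γ) ⊓ α, hL.2 (hL.1 hr hγ) hα, ?_, ?_, ?_⟩
  · intro i hi
    refine ⟨?_, hαa i (by omega)⟩
    rcases Nat.lt_succ_iff_lt_or_eq.1 hi with hi | rfl
    · exact le_sup_left (a := r) (hra i hi)
    · exact rel_trans (le_sup_right (b := γ) (hγab j (by omega)))
        (rel_trans (le_sup_left (a := r) (hrb j (by omega)))
          (le_sup_right (b := γ) (rel_symm (hγab (j + 1) (by omega)))))
  · exact fun i hi => ⟨le_sup_left (a := r) (hrb i hi), hαb i (by omega)⟩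
  · have h : r ⊔ γ ≤ Setoid.ker (label k a b (fun i => max i (j + 2))
        (fun i => max (i + 1) (j + 2)) (max (t + 1) (j + 2))) :=
      sup_le (C.le_ker_label hr' hr' (by grind) (by grind) (by grind) (by grind) (by grind))
        (C.le_ker_label hγ' hγ' (by grind) (by grind) (by grind) (by grind) (by grind))
    exact C.le_ker_label (inf_le_of_left_le h) (inf_le_of_right_le hα')
      (by grind) (by grind) (by grind) (by grind) (by grind)

lemma exists_isInitial (C : IsConfiguration k a b c) (hL : IsSublattice L)
    (hα : α ∈ L) (hβ : β ∈ L) (hγ : γ ∈ L) (hαa : ∀ i < k, α (a i) (a (i + 1)))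
    (hαb : ∀ i, i + 1 < k → α (b i) (b (i + 1)))
    (hα' : α ≤ Setoid.ker (label k a b (fun _ => 0) (fun _ => 1) 2))
    (hβab : ∀ i < k, β (a i) (b i))
    (hβ' : β ≤ Setoid.ker (label k a b (fun i => i) (fun i => i) s))
    (hγab : ∀ i < k, γ (a (i + 1)) (b i))
    (hγ' : γ ≤ Setoid.ker (label k a b (fun i => i) (fun i => i + 1) (t + 1)))
    (h0 : equ (a 0) (b 0) ∈ L) (j : ℕ) (hj : j < k) :
    (∃ r ∈ L, IsInitial k a b r (j + 1) j) ∧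
      (j + 1 < k → ∃ r ∈ L, IsInitial k a b r (j + 1) (j + 1)) := by
  have key : ∃ r ∈ L, IsInitial k a b r (j + 1) j := by
    induction j with
    | zero => exact C.exists_isInitial_one hL hα hγ hj hαa hα' hγab hγ' h0
    | succ j ih =>
      exact C.exists_isInitial_succ_left hL hα hγ hαa hαb hα' hγab hγ' hj
        (C.exists_isInitial_succ_right hL hα hβ hαa hαb hα' hβab hβ' hj (ih (by omega)))
  exact ⟨key, fun hj' =>
    C.exists_isInitial_succ_right hL hα hβ hαa hαb hα' hβab hβ' hj' key⟩

lemma inf_eq_equ_a (C : IsConfiguration k a b c) {l r : Setoid A} {j : ℕ} (hj : j < k)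
    (hl : IsInitial k a b l (j + 1) (j))
    (hr : IsInitial k (fun i => a (k - i)) (fun i => b (k - 1 - i)) r (k - 1 - j + 1) (k - 1 - j)) :
    l ⊓ r = equ (a j) (a (j + 1)) := by
  have hrj := rel_symm (hr.rel_a (k - 1 - j) (by omega))
  have hr' := hr.le_ker
  rw [show k - (k - 1 - j + 1) = j by omega, show k - (k - 1 - j) = j + 1 by omega] at hrj
  rw [C.label_reverse] at hr'
  refine C.eq_equ ⟨hl.rel_a j (by omega), hrj⟩ (inf_le_of_left_le hl.le_ker)
    (inf_le_of_right_le hr') ?_ ?_ ?_ ?_ ?_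
  · intro p hp q hq hpq e e'
    obtain rfl : p = j := by omega
    obtain rfl : q = p + 1 := by omega
    exact ⟨rfl, rfl⟩
  · intro p hp q hq hpq e e'
    omega
  all_goals intros; omega

lemma inf_eq_equ_b (C : IsConfiguration k a b c) {l r : Setoid A} {j : ℕ} (hj : j + 1 < k)
    (hl : IsInitial k a b l (j + 1) (j + 1))
    (hr : IsInitial k (fun i => a (k - i)) (fun i => b (k - 1 - i)) r (k - 2 - j + 1) (k - 2 - j + 1)) :
    l ⊓ r = equ (b j) (b (j + 1)) := by
  have hrj := rel_symm (hr.rel_b (k - 2 - j) (by omega))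
  have hr' := hr.le_ker
  rw [show k - 1 - (k - 2 - j + 1) = j by omega, show k - 1 - (k - 2 - j) = j + 1 by omega] at hrj
  rw [C.label_reverse] at hr'
  refine C.eq_equ ⟨hl.rel_b j (by omega), hrj⟩ (inf_le_of_left_le hl.le_ker)
    (inf_le_of_right_le hr') ?_ ?_ ?_ ?_ ?_
  · intro p hp q hq hpq e e'
    omega
  · intro p hp q hq hpq e e'
    obtain rfl : p = j := by omega
    obtain rfl : q = p + 1 := by omega
    exact ⟨rfl, rfl⟩
  all_goals intros; omega

lemma equ_edge_mem (C : IsConfiguration k a b c) (hL : IsSublattice L)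
    (hα : α ∈ L) (hβ : β ∈ L) (hγ : γ ∈ L) (hαa : ∀ i < k, α (a i) (a (i + 1)))
    (hαb : ∀ i, i + 1 < k → α (b i) (b (i + 1)))
    (hα' : α ≤ Setoid.ker (label k a b (fun _ => 0) (fun _ => 1) 2))
    (hβab : ∀ i < k, β (a i) (b i))
    (hβ' : β ≤ Setoid.ker (label k a b (fun i => i) (fun i => i) s))
    (hγab : ∀ i < k, γ (a (i + 1)) (b i))
    (hγ' : γ ≤ Setoid.ker (label k a b (fun i => i) (fun i => i + 1) (t + 1)))
    (hs : s < k) (ht : t < k)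
    (h0 : equ (a 0) (b 0) ∈ L) (h1 : equ (a k) (b (k - 1)) ∈ L) :
    (∀ j < k, equ (a j) (a (j + 1)) ∈ L) ∧
      ∀ j, j + 1 < k → equ (b j) (b (j + 1)) ∈ L := by
  have left := C.exists_isInitial hL hα hβ hγ hαa hαb hα' hβab hβ' hγab hγ' h0
  have right := C.reverse.exists_isInitial (s := k - 1 - t) (t := k - 1 - s)
    hL hα hγ hβ
    (fun i hi => by
      have := rel_symm (hαa (k - (i + 1)) (by omega))
      rwa [show k - (i + 1) + 1 = k - i by omega] at this)
    (fun i hi => by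
      have := rel_symm (hαb (k - 1 - (i + 1)) (by omega))
      rwa [show k - 1 - (i + 1) + 1 = k - 1 - i by omega] at this)
    (by rw [C.label_reverse]; exact hα')
    (fun i hi => by
      have := hγab (k - 1 - i) (by omega)
      rwa [show k - 1 - i + 1 = k - i by omega] at this)
    (by
      rw [C.label_reverse]
      exact C.le_ker_label hγ' hγ' (by grind) (by grind) (by grind) (by grind) (by grind))
    (fun i hi => by
      have := hβab (k - 1 - i) (by omega)
      rwa [show k - 1 - i = k - (i + 1) by omega] at this ⊢)
    (by
      rw [C.label_reverse]
      exact C.le_ker_label hβ' hβ' (by grind) (by grind) (by grind) (by grind) (by grind))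
    (by simpa using h1)
  refine ⟨fun j hj => ?_, fun j hj => ?_⟩
  · obtain ⟨l, hl, hl'⟩ := (left j hj).1
    obtain ⟨r, hr, hr'⟩ := (right (k - 1 - j) (by omega)).1
    exact C.inf_eq_equ_a hj hl' hr' ▸ hL.2 hl hr
  · obtain ⟨l, hl, hl'⟩ := (left j (by omega)).2 hj
    obtain ⟨r, hr, hr'⟩ := (right (k - 2 - j) (by omega)).2 (by omega)
    exact C.inf_eq_equ_b hj hl' hr' ▸ hL.2 hl hr

lemma equ_rung_mem (C : IsConfiguration k a b c) (hL : IsSublattice L)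
    (hβ : β ∈ L) (hγ : γ ∈ L) (hβab : ∀ i < k, β (a i) (b i))
    (hβ' : β ≤ Setoid.ker (label k a b (fun i => i) (fun i => i) s))
    (hγab : ∀ i < k, γ (a (i + 1)) (b i))
    (hγ' : γ ≤ Setoid.ker (label k a b (fun i => i) (fun i => i + 1) (t + 1)))
    (h0 : equ (a 0) (b 0) ∈ L) (haa : ∀ j < k, equ (a j) (a (j + 1)) ∈ L)
    (hbb : ∀ j, j + 1 < k → equ (b j) (b (j + 1)) ∈ L) (i : ℕ) (hi : i < k) :
    equ (a i) (b i) ∈ L ∧ equ (b i) (a (i + 1)) ∈ L := by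
  have step (i : ℕ) (hi : i < k) (h : equ (a i) (b i) ∈ L) : equ (b i) (a (i + 1)) ∈ L := by
    refine equ_mem_of_triangle hL hγ (y := a i) (equ_comm (a i) (b i) ▸ h) (haa i hi)
      (rel_symm (hγab i hi)) fun h => ?_
    have := hγ' h
    rw [Setoid.ker_def, C.label_a _ _ _ (by omega), C.label_b _ _ _ hi] at this
    omega
  have key : equ (a i) (b i) ∈ L := by
    induction i with
    | zero => exact h0
    | succ i ih =>
      have hi' := step i (by omega) (ih (by omega))
      refine equ_mem_of_triangle hL hβ (y := b i) (equ_comm (b i) _ ▸ hi') (hbb i hi)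
        (hβab _ hi) fun h => ?_
      have := hβ' h
      rw [Setoid.ker_def, C.label_a _ _ _ (by omega), C.label_b _ _ _ (by omega)] at this
      omega
  exact ⟨key, step i hi key⟩

lemma equ_mem_of_strip (C : IsConfiguration k a b c) (hL : IsSublattice L) (h0 : ⊥ ∈ L)
    (haa : ∀ j < k, equ (a j) (a (j + 1)) ∈ L)
    (hbb : ∀ j, j + 1 < k → equ (b j) (b (j + 1)) ∈ L)
    (hab : ∀ i < k, equ (a i) (b i) ∈ L ∧ equ (b i) (a (i + 1)) ∈ L)
    {x y : A} (hx : x ≠ c) (hy : y ≠ c) : equ x y ∈ L := by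
  let v : ℕ → A := fun n => if n % 2 = 0 then a (n / 2) else b (n / 2)
  have v_even (i : ℕ) : v (2 * i) = a i := by simp [v]
  have v_odd (i : ℕ) : v (2 * i + 1) = b i := by
    simp [v, show (2 * i + 1) / 2 = i by omega, Nat.add_mod]
  have path := equ_mem_of_path (v := v) (N := 2 * k) hL h0
    (fun n hn => by
      rcases Nat.even_or_odd' n with ⟨i, rfl | rfl⟩
      · rw [v_even, v_odd]
        exact C.a_ne_b _ (by omega) _ (by omega)
      · rw [v_odd, show 2 * i + 1 + 1 = 2 * (i + 1) by omega, v_even]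
        exact (C.a_ne_b _ (by omega) _ (by omega)).symm)
    (fun n hn => by
      rcases Nat.even_or_odd' n with ⟨i, rfl | rfl⟩
      · rw [v_even, v_odd]
        exact (hab i (by omega)).1
      · rw [v_odd, show 2 * i + 1 + 1 = 2 * (i + 1) by omega, v_even]
        exact (hab i (by omega)).2)
    (fun n hn => by
      rcases Nat.even_or_odd' n with ⟨i, rfl | rfl⟩
      · rw [show 2 * i + 2 = 2 * (i + 1) by omega, v_even, v_even]
        exact haa i (by omega)
      · rw [show 2 * i + 1 + 2 = 2 * (i + 1) + 1 by omega, v_odd, v_odd]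
        exact hbb i (by omega))
  have cover (z : A) (hz : z ≠ c) : ∃ n ≤ 2 * k, z = v n := by
    rcases C.cover z with ⟨i, hi, rfl⟩ | ⟨i, hi, rfl⟩ | rfl
    · exact ⟨2 * i, by omega, (v_even i).symm⟩
    · exact ⟨2 * i + 1, by omega, (v_odd i).symm⟩
    · exact absurd rfl hz
  obtain ⟨p, hp, rfl⟩ := cover x hx
  obtain ⟨q, hq, rfl⟩ := cover y hy
  rcases le_total p q with h | h
  · obtain ⟨d, rfl⟩ := Nat.exists_eq_add_of_le h
    exact path d p hq
  · obtain ⟨d, rfl⟩ := Nat.exists_eq_add_of_le h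
    exact equ_comm (v q) _ ▸ path d q hp

lemma equ_apex_mem (C : IsConfiguration k a b c) (hL : IsSublattice L)
    (hβ : β ∈ L) (hγ : γ ∈ L) (hβab : ∀ i < k, β (a i) (b i)) (hβc : β (b s) c)
    (hβ' : β ≤ Setoid.ker (label k a b (fun i => i) (fun i => i) s))
    (hγab : ∀ i < k, γ (a (i + 1)) (b i)) (hγc : γ (b t) c)
    (hγ' : γ ≤ Setoid.ker (label k a b (fun i => i) (fun i => i + 1) (t + 1)))
    (hst : s < t) (ht : t < k)
    (h : ∀ x y, x ≠ c → y ≠ c → equ x y ∈ L) :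
    equ (a s) c ∈ L ∧ equ (a (t + 1)) c ∈ L := by
  have h1 : equ (a s) c ∈ L := by
    have hj : γ ⊔ equ (b t) (a s) ≤ Setoid.ker
        (label k a b (fun i => if i = s then t + 1 else i)
          (fun i => if i + 1 = s then t + 1 else i + 1) (t + 1)) := by
      refine sup_le (C.le_ker_label hγ' hγ' ?_ ?_ ?_ ?_ ?_) (equ_le_iff.2 ?_)
      rotate_right
      · rw [Setoid.ker_def, C.label_a _ _ _ (by omega), C.label_b _ _ _ ht]
        grind
      all_goals grind
    rw [← C.eq_equ (r := β ⊓ (γ ⊔ equ (b t) (a s))) ⟨rel_trans (hβab s (by omega)) hβc, ?_⟩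
      (inf_le_of_left_le hβ') (inf_le_of_right_le hj) (by grind) (by grind) (by grind)
      (by grind) (by grind)]
    · exact hL.2 hβ (hL.1 hγ (h _ _ (C.b_ne_c _ ht) (C.a_ne_c _ (by omega))))
    · exact rel_trans (le_sup_right (a := γ) (rel_symm (equ_rel (b t) (a s))))
        (le_sup_left (a := γ) hγc)
  refine ⟨h1, ?_⟩
  refine equ_mem_of_triangle hL hγ (y := a s)
    (h _ _ (C.a_ne_c _ (by omega)) (C.a_ne_c _ (by omega))) h1
    (rel_trans (hγab t ht) hγc) fun h => ?_
  have := hγ' h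
  rw [Setoid.ker_def, C.label_a _ _ _ (by omega), C.label_a _ _ _ (by omega)] at this
  omega

end IsConfiguration

/-- **Even case of the configuration with a nontrivial necktie.**
Let `k ≥ 2`, `m = 2k - 3`, and let `A` consist of the `2k + 2` pairwise distinct
elements `a 0, …, a k, b 0, …, b (k-1), c`.  Let `0 ≤ s < t ≤ k - 1`.  The edges are
`I (2j) = (a j, a (j+1))` for `0 ≤ j ≤ k-1` and `I (2j+1) = (b j, b (j+1))` for
`0 ≤ j ≤ k-2`; `edge r` is the atom of `Equ(A)` collapsing the endpoints of `I r`.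
For an arbitrary `Z ⊆ {1, …, m}` define
`α = (⨆_{j<k} equ (a j) (a (j+1))) ⊔ (⨆_{j<k-1} equ (b j) (b (j+1)))`,
`β = equ (b s) c ⊔ ⨆_{i<k} equ (a i) (b i)`,
`γ = equ (b t) c ⊔ ⨆_{i<k} equ (a (i+1)) (b i)`, and
`δ = equ (a 0) (b 0) ⊔ equ (a k) (b (k-1)) ⊔ ⨆_{i ∈ Z} edge i`.
Then `{α, β, γ, δ}` generates the lattice `Equ(A) = Setoid A`. -/
theorem necktie_configuration_generates {A : Type*}
    (k : ℕ) (hk : 2 ≤ k) (m : ℕ) (hm : m = 2 * k - 3)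
    (a b : ℕ → A) (c : A)
    (ha : ∀ i ≤ k, ∀ j ≤ k, a i = a j → i = j)
    (hb : ∀ i < k, ∀ j < k, b i = b j → i = j)
    (hab : ∀ i ≤ k, ∀ j < k, a i ≠ b j)
    (hac : ∀ i ≤ k, a i ≠ c)
    (hbc : ∀ j < k, b j ≠ c)
    (hcover : ∀ x : A, (∃ i ≤ k, x = a i) ∨ (∃ j < k, x = b j) ∨ x = c)
    (s t : ℕ) (hst : s < t) (htk : t ≤ k - 1)
    (Z : Finset ℕ) (hZ : Z ⊆ Finset.Icc 1 m)
    (edge : ℕ → Setoid A)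
    (hedge : ∀ r, edge r = if r % 2 = 0 then equ (a (r / 2)) (a (r / 2 + 1))
                           else equ (b (r / 2)) (b (r / 2 + 1)))
    (α β γ δ : Setoid A)
    (hα : α = (⨆ j ∈ Finset.range k, equ (a j) (a (j + 1))) ⊔
              (⨆ j ∈ Finset.range (k - 1), equ (b j) (b (j + 1))))
    (hβ : β = equ (b s) c ⊔ ⨆ i ∈ Finset.range k, equ (a i) (b i))
    (hγ : γ = equ (b t) c ⊔ ⨆ i ∈ Finset.range k, equ (a (i + 1)) (b i))
    (hδ : δ = equ (a 0) (b 0) ⊔ equ (a k) (b (k - 1)) ⊔ ⨆ i ∈ Z, edge i) :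
    latticeClosure {α, β, γ, δ} = Set.univ := by
  have C : IsConfiguration k a b c := ⟨ha, hb, hab, hac, hbc, hcover⟩
  have hL : IsSublattice (latticeClosure {α, β, γ, δ}) := isSublattice_latticeClosure
  have hsub : {α, β, γ, δ} ⊆ latticeClosure {α, β, γ, δ} := subset_latticeClosure
  generalize latticeClosure {α, β, γ, δ} = L at hL hsub ⊢
  have mα : α ∈ L := hsub (by simp)
  have mβ : β ∈ L := hsub (by simp)
  have mγ : γ ∈ L := hsub (by simp)
  have mδ : δ ∈ L := hsub (by simp)
  have hαa : ∀ i < k, α (a i) (a (i + 1)) := fun i hi => equ_le_iff.1 <| hα ▸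
    le_sup_of_le_left (le_iSup₂_of_le i (Finset.mem_range.2 hi) le_rfl)
  have hαb : ∀ i, i + 1 < k → α (b i) (b (i + 1)) := fun i hi => equ_le_iff.1 <| hα ▸
    le_sup_of_le_right (le_iSup₂_of_le i (Finset.mem_range.2 (by omega)) le_rfl)
  have hβab : ∀ i < k, β (a i) (b i) := fun i hi => equ_le_iff.1 <| hβ ▸
    le_sup_of_le_right (le_iSup₂_of_le i (Finset.mem_range.2 hi) le_rfl)
  have hγab : ∀ i < k, γ (a (i + 1)) (b i) := fun i hi => equ_le_iff.1 <| hγ ▸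
    le_sup_of_le_right (le_iSup₂_of_le i (Finset.mem_range.2 hi) le_rfl)
  have hβc : β (b s) c := equ_le_iff.1 (hβ ▸ le_sup_left)
  have hγc : γ (b t) c := equ_le_iff.1 (hγ ▸ le_sup_left)
  have hδ0 : δ (a 0) (b 0) := equ_le_iff.1 (hδ ▸ le_sup_of_le_left le_sup_left)
  have hδ1 : δ (a k) (b (k - 1)) := equ_le_iff.1 (hδ ▸ le_sup_of_le_left le_sup_right)
  have hα' : α ≤ Setoid.ker (label k a b (fun _ => 0) (fun _ => 1) 2) := by
    rw [hα]
    refine sup_le (iSup₂_le fun i hi => equ_le_iff.2 ?_) (iSup₂_le fun i hi => equ_le_iff.2 ?_) <;>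
      rw [Finset.mem_range] at hi <;> rw [Setoid.ker_def]
    · rw [C.label_a _ _ _ (by omega), C.label_a _ _ _ (by omega)]
    · rw [C.label_b _ _ _ (by omega), C.label_b _ _ _ (by omega)]
  have hβ' : β ≤ Setoid.ker (label k a b (fun i => i) (fun i => i) s) := by
    rw [hβ]
    refine sup_le (equ_le_iff.2 ?_) (iSup₂_le fun i hi => equ_le_iff.2 ?_) <;> rw [Setoid.ker_def]
    · rw [C.label_b _ _ _ (by omega), C.label_c]
    · rw [Finset.mem_range] at hi
      rw [C.label_a _ _ _ (by omega), C.label_b _ _ _ (by omega)]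
  have hγ' : γ ≤ Setoid.ker (label k a b (fun i => i) (fun i => i + 1) (t + 1)) := by
    rw [hγ]
    refine sup_le (equ_le_iff.2 ?_) (iSup₂_le fun i hi => equ_le_iff.2 ?_) <;> rw [Setoid.ker_def]
    · rw [C.label_b _ _ _ (by omega), C.label_c]
    · rw [Finset.mem_range] at hi
      rw [C.label_a _ _ _ (by omega), C.label_b _ _ _ (by omega)]
  have hδ' : δ ≤ Setoid.ker
      (label k a b (fun i => if i = 0 ∨ i = k then 0 else 1) (fun _ => 0) 2) := by
    rw [hδ]
    refine sup_le (sup_le (equ_le_iff.2 ?_) (equ_le_iff.2 ?_)) (iSup₂_le fun r hr => ?_)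
    · rw [Setoid.ker_def, C.label_a _ _ _ (by omega), C.label_b _ _ _ (by omega)]
      simp
    · rw [Setoid.ker_def, C.label_a _ _ _ (by omega), C.label_b _ _ _ (by omega)]
      simp
    · have := Finset.mem_Icc.1 (hZ hr)
      rw [hedge]
      split_ifs with hpar <;> rw [equ_le_iff, Setoid.ker_def]
      · rw [C.label_a _ _ _ (by omega), C.label_a _ _ _ (by omega), if_neg (by omega),
          if_neg (by omega)]
      · rw [C.label_b _ _ _ (by omega), C.label_b _ _ _ (by omega)]
  have h0 : equ (a 0) (b 0) ∈ L := by
    rw [← C.eq_equ (r := β ⊓ δ) ⟨hβab 0 (by omega), hδ0⟩ (inf_le_of_left_le hβ')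
      (inf_le_of_right_le hδ') (by grind) (by grind) (by grind) (by grind) (by grind)]
    exact hL.2 mβ mδ
  have h1 : equ (a k) (b (k - 1)) ∈ L := by
    have hγk := hγab (k - 1) (by omega)
    rw [show k - 1 + 1 = k by omega] at hγk
    rw [← C.eq_equ (r := γ ⊓ δ) ⟨hγk, hδ1⟩ (inf_le_of_left_le hγ')
      (inf_le_of_right_le hδ') (by grind) (by grind) (by grind) (by grind) (by grind)]
    exact hL.2 mγ mδ
  obtain ⟨haa, hbb⟩ := C.equ_edge_mem hL mα mβ mγ hαa hαb hα' hβab hβ' hγab hγ'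
    (by omega) (by omega) h0 h1
  have hbot : ⊥ ∈ L := by
    rw [← equ_self c, ← C.eq_equ (r := equ (a 0) (b 0) ⊓ α) (Setoid.refl' _ c)
      (inf_le_of_left_le (equ_le_iff.2 (hβab 0 (by omega)) |>.trans hβ'))
      (inf_le_of_right_le hα') (by grind) (by grind) (by grind) (by grind) (by grind)]
    exact hL.2 h0 mα
  have hstrip : ∀ x y, x ≠ c → y ≠ c → equ x y ∈ L := fun x y =>
    C.equ_mem_of_strip hL hbot haa hbb
      (C.equ_rung_mem hL mβ mγ hβab hβ' hγab hγ' h0 haa hbb)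
  obtain ⟨hs, ht⟩ := C.equ_apex_mem hL mβ mγ hβab hβc hβ' hγab hγc hγ' hst (by omega) hstrip
  have hapex : ∀ x, x ≠ c → equ x c ∈ L := fun x hx =>
    equ_mem_of_square hL (hstrip x _ hx (hac s (by omega))) hs
      (hstrip x _ hx (hac (t + 1) (by omega))) ht
      fun h => by have := ha _ (by omega) _ (by omega) h; omega
  have := C.finite
  have : Nonempty A := ⟨c⟩
  refine eq_univ_of_forall_equ_mem hL fun x y => ?_
  by_cases hx : x = c <;> by_cases hy : y = c
  · rw [hx, hy, equ_self]
    exact hbot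
  · rw [hx, equ_comm]
    exact hapex y hy
  · rw [hy]
    exact hapex x hx
  · exact hstrip x y hx hy
end

section
/- For every integer n ≥ 7, the number γ(n) of four-element generating sets of the partition lattice Part(n) satisfies γ(n) ≥ (1/2) · n! · C(h(n), 2)^{e(n)} · B_{h(n)−1} · B_{h(n)}, where h(n) = ⌊(n−1)/2⌋, e(n) = 0 if n is odd and e(n) = 1 if n is even, C(·,·) denotes the binomial coefficient, and B_k denotes the k-th Bell number. -/
/-- `numGen n` is the number `γ(n)` of four-element generating sets of the partition
lattice `Part(n) = Setoid (Fin n)`: four-element subsets whose closure under binary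
meets and joins is the whole lattice. -/
noncomputable def numGen (n : ℕ) : ℕ :=
  Nat.card {X : Finset (Setoid (Fin n)) //
    X.card = 4 ∧ latticeClosure (X : Set (Setoid (Fin n))) = Set.univ}

/-- The `k`-th Bell number: the number of partitions of a `k`-element set, i.e. the
number of equivalence relations on `Fin k`. -/
noncomputable def bell (k : ℕ) : ℕ := Nat.card (Setoid (Fin k))

namespace PartitionLattice

section Block

variable {V : Type*}

/-- The equivalence relation whose only possibly nontrivial class is `A`. -/
def block (A : Set V) : Setoid V where
  r x y := x = y ∨ (x ∈ A ∧ y ∈ A)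
  iseqv := by
    refine ⟨fun x => Or.inl rfl, ?_, ?_⟩
    · rintro x y (rfl | ⟨hx, hy⟩)
      · exact Or.inl rfl
      · exact Or.inr ⟨hy, hx⟩
    · rintro x y z (rfl | ⟨hx, hy⟩) (rfl | ⟨hy', hz⟩)
      · exact Or.inl rfl
      · exact Or.inr ⟨hy', hz⟩
      · exact Or.inr ⟨hx, hy⟩
      · exact Or.inr ⟨hx, hz⟩

theorem block_rel {A : Set V} {x y : V} : block A x y ↔ x = y ∨ (x ∈ A ∧ y ∈ A) := Iff.rfl

theorem block_le {A : Set V} {r : Setoid V} : block A ≤ r ↔ ∀ x ∈ A, ∀ y ∈ A, r x y := by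
  constructor
  · exact fun h x hx y hy => h (Or.inr ⟨hx, hy⟩)
  · rintro h x y (rfl | ⟨hx, hy⟩)
    · exact r.refl' _
    · exact h x hx y hy

theorem block_pair_le {x y : V} {r : Setoid V} : block {x, y} ≤ r ↔ r x y := by
  rw [block_le]
  constructor
  · exact fun h => h x (by simp) y (by simp)
  · rintro h a (rfl | rfl) b (rfl | rfl)
    exacts [r.refl' _, h, r.symm' h, r.refl' _]

theorem block_mono {A B : Set V} (h : A ⊆ B) : block A ≤ block B :=
  block_le.2 fun _ hx _ hy => Or.inr ⟨h hx, h hy⟩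

theorem block_inf (A B : Set V) : block A ⊓ block B = block (A ∩ B) := by
  ext x y
  simp only [Setoid.inf_iff_and, block_rel, Set.mem_inter_iff]
  tauto

theorem block_sup {A B : Set V} (h : (A ∩ B).Nonempty) :
    block A ⊔ block B = block (A ∪ B) := by
  obtain ⟨v, hvA, hvB⟩ := h
  refine le_antisymm (sup_le (block_mono Set.subset_union_left)
    (block_mono Set.subset_union_right)) (block_le.2 ?_)
  have key : ∀ x ∈ A ∪ B, (block A ⊔ block B) x v := by
    rintro x (hx | hx)
    · exact (le_sup_left : block A ≤ _) (Or.inr ⟨hx, hvA⟩)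
    · exact (le_sup_right : block B ≤ _) (Or.inr ⟨hx, hvB⟩)
  exact fun x hx y hy => Setoid.trans' _ (key x hx) (Setoid.symm' _ (key y hy))

theorem block_subsingleton {A : Set V} (h : A.Subsingleton) : block A = ⊥ :=
  le_bot_iff.1 (block_le.2 fun _ hx _ hy => h hx hy)

/-- A diagonal of a quadrangle is the meet of the joins of the two pairs of adjacent sides. -/
theorem block_pair_mem_of_quadrangle {S : Set (Setoid V)} (hS : IsSublattice S) {x y w z : V}
    (hyw : y ≠ w) (hxy : block {x, y} ∈ S) (hyz : block {y, z} ∈ S)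
    (hxw : block {x, w} ∈ S) (hwz : block {w, z} ∈ S) : block {x, z} ∈ S := by
  have h1 := hS.supClosed hxy hyz
  have h2 := hS.supClosed hxw hwz
  rw [block_sup ⟨y, by simp⟩] at h1
  rw [block_sup ⟨w, by simp⟩] at h2
  have h3 := hS.infClosed h1 h2
  rw [block_inf] at h3
  convert h3 using 2
  ext v
  simp only [Set.mem_insert_iff, Set.mem_singleton_iff, Set.mem_inter_iff, Set.mem_union]
  grind

theorem eq_univ_of_block_pair_mem [Finite V] {S : Set (Setoid V)} (hS : IsSublattice S)
    (hbot : ⊥ ∈ S) (h : ∀ x y : V, x ≠ y → block {x, y} ∈ S) : S = Set.univ := by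
  classical
  have := Fintype.ofFinite V
  refine Set.eq_univ_of_forall fun r => ?_
  have hr : r = (Finset.univ.filter fun p : V × V => r p.1 p.2).sup
      fun p => block {p.1, p.2} := by
    refine le_antisymm (fun x y hxy => ?_) (Finset.sup_le fun p hp => ?_)
    · have : block {x, y} ≤ (Finset.univ.filter fun p : V × V => r p.1 p.2).sup
          fun p => block {p.1, p.2} :=
        Finset.le_sup (f := fun p : V × V => block {p.1, p.2}) (b := (x, y)) (by simpa using hxy)
      exact block_pair_le.1 this
    · exact block_pair_le.2 (by simpa using hp)
  rw [hr]
  refine Finset.sup_induction hbot (fun a ha b hb => hS.supClosed ha hb) fun p _ => ?_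
  by_cases hp : p.1 = p.2
  · rw [hp, block_subsingleton (by simp)]
    exact hbot
  · exact h _ _ hp

end Block

section Zigzag

variable {V : Type*}

/-- Vertices with labels at most `2 * k` are split by parity; label `2 * k + 1` is isolated. -/
def parityRel (k : ℕ) (lab : V → ℕ) : Setoid V :=
  Setoid.ker fun v => if lab v = 2 * k + 1 then 2 else lab v % 2

/-- The matching `{0, 1}, {2, 3}, …` of labels, with `2 * k + 1` attached to `{2 * i, 2 * i + 1}`. -/
def evenMatch (k i : ℕ) (lab : V → ℕ) : Setoid V :=
  Setoid.ker fun v => if lab v = 2 * k + 1 then i else lab v / 2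

/-- The matching `{1, 2}, {3, 4}, …` of labels, with `2 * k + 1` attached to
`{2 * j + 1, 2 * j + 2}`. -/
def oddMatch (k j : ℕ) (lab : V → ℕ) : Setoid V :=
  Setoid.ker fun v => if lab v = 2 * k + 1 then j + 1 else (lab v + 1) / 2

/-- The class of `x` under `p`, or `none` if `x` is out of range. -/
def classOf {m : ℕ} (p : Setoid (Fin m)) (x : ℕ) : Option (Quotient p) :=
  if h : x < m then some (Quotient.mk p ⟨x, h⟩) else none

theorem classOf_eq {m : ℕ} (p : Setoid (Fin m)) (x y : Fin m) :
    classOf p x = classOf p y ↔ p x y := by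
  simp [classOf, Quotient.eq]

/-- The labels `2, 4, …, 2 * k - 2` are partitioned by `p`, the labels `1, 3, …, 2 * k - 1`
by `q`, the label `0` is attached to `1`, the label `2 * k` to `2 * k - 1`, and `2 * k + 1` is
isolated. -/
def linkRel (k : ℕ) (p : Setoid (Fin (k - 1))) (q : Setoid (Fin k)) (lab : V → ℕ) : Setoid V :=
  Setoid.ker fun v =>
    if lab v = 2 * k + 1 then ((2 : ℕ), none, none)
    else if lab v % 2 = 0 ∧ lab v ≠ 0 ∧ lab v ≠ 2 * k then (0, classOf p (lab v / 2 - 1), none)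
    else (1, none, classOf q (min (lab v / 2) (k - 1)))

theorem parityRel_rel {k : ℕ} {lab : V → ℕ} {x y : V} : parityRel k lab x y ↔
    (if lab x = 2 * k + 1 then 2 else lab x % 2) =
      (if lab y = 2 * k + 1 then 2 else lab y % 2) := Iff.rfl

theorem evenMatch_rel {k i : ℕ} {lab : V → ℕ} {x y : V} : evenMatch k i lab x y ↔
    (if lab x = 2 * k + 1 then i else lab x / 2) =
      (if lab y = 2 * k + 1 then i else lab y / 2) := Iff.rfl

theorem oddMatch_rel {k j : ℕ} {lab : V → ℕ} {x y : V} : oddMatch k j lab x y ↔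
    (if lab x = 2 * k + 1 then j + 1 else (lab x + 1) / 2) =
      (if lab y = 2 * k + 1 then j + 1 else (lab y + 1) / 2) := Iff.rfl

theorem linkRel_tag {k : ℕ} {p : Setoid (Fin (k - 1))} {q : Setoid (Fin k)} {lab : V → ℕ}
    {x y : V} (h : linkRel k p q lab x y) :
    (if lab x = 2 * k + 1 then 2
      else if lab x % 2 = 0 ∧ lab x ≠ 0 ∧ lab x ≠ 2 * k then 0 else 1) =
    (if lab y = 2 * k + 1 then 2
      else if lab y % 2 = 0 ∧ lab y ≠ 0 ∧ lab y ≠ 2 * k then 0 else 1) := by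
  have h' := congrArg Prod.fst (show _ = _ from h)
  dsimp only at h'
  split_ifs at h' ⊢ <;> simp_all

theorem linkRel_inf_evenMatch {k i : ℕ} {p : Setoid (Fin (k - 1))} {q : Setoid (Fin k)}
    {lab : V → ℕ} (hinj : Function.Injective lab) (hle : ∀ v, lab v ≤ 2 * k + 1) (hk : 1 ≤ k) :
    linkRel k p q lab ⊓ evenMatch k i lab = block {v | lab v ≤ 1} := by
  refine le_antisymm ?_ (le_inf (block_le.2 ?_) (block_le.2 ?_))
  · rintro x y ⟨hd, hb⟩
    have hd := linkRel_tag hd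
    replace hb := evenMatch_rel.1 hb
    have hx := hle x
    have hy := hle y
    by_cases hxy : lab x = lab y
    · exact Or.inl (hinj hxy)
    · refine Or.inr ?_
      simp only [Set.mem_ofPred_eq]
      split_ifs at hd hb <;> omega
  · intro x hx y hy
    simp only [Set.mem_ofPred_eq] at hx hy
    have e1 : ¬ lab x = 2 * k + 1 := by omega
    have e2 : ¬ lab y = 2 * k + 1 := by omega
    have e3 : ¬ (lab x % 2 = 0 ∧ lab x ≠ 0 ∧ lab x ≠ 2 * k) := by omega
    have e4 : ¬ (lab y % 2 = 0 ∧ lab y ≠ 0 ∧ lab y ≠ 2 * k) := by omega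
    have e5 : lab x / 2 = lab y / 2 := by omega
    change ite _ _ _ = ite _ _ _
    rw [if_neg e1, if_neg e2, if_neg e3, if_neg e4, e5]
  · intro x hx y hy
    simp only [Set.mem_ofPred_eq] at hx hy
    rw [evenMatch_rel]
    split_ifs <;> omega

theorem linkRel_inf_oddMatch {k j : ℕ} {p : Setoid (Fin (k - 1))} {q : Setoid (Fin k)}
    {lab : V → ℕ} (hinj : Function.Injective lab) (hle : ∀ v, lab v ≤ 2 * k + 1) (hk : 1 ≤ k) :
    linkRel k p q lab ⊓ oddMatch k j lab = block {v | 2 * k - 1 ≤ lab v ∧ lab v ≤ 2 * k} := by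
  refine le_antisymm ?_ (le_inf (block_le.2 ?_) (block_le.2 ?_))
  · rintro x y ⟨hd, hb⟩
    have hd := linkRel_tag hd
    replace hb := oddMatch_rel.1 hb
    have hx := hle x
    have hy := hle y
    by_cases hxy : lab x = lab y
    · exact Or.inl (hinj hxy)
    · refine Or.inr ?_
      simp only [Set.mem_ofPred_eq]
      split_ifs at hd hb <;> omega
  · intro x hx y hy
    simp only [Set.mem_ofPred_eq] at hx hy
    have e1 : ¬ lab x = 2 * k + 1 := by omega
    have e2 : ¬ lab y = 2 * k + 1 := by omega
    have e3 : ¬ (lab x % 2 = 0 ∧ lab x ≠ 0 ∧ lab x ≠ 2 * k) := by omega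
    have e4 : ¬ (lab y % 2 = 0 ∧ lab y ≠ 0 ∧ lab y ≠ 2 * k) := by omega
    have e5 : min (lab x / 2) (k - 1) = min (lab y / 2) (k - 1) := by omega
    change ite _ _ _ = ite _ _ _
    rw [if_neg e1, if_neg e2, if_neg e3, if_neg e4, e5]
  · intro x hx y hy
    simp only [Set.mem_ofPred_eq] at hx hy
    rw [oddMatch_rel]
    split_ifs <;> omega

theorem block_initial_succ {k m : ℕ} {lab : V → ℕ} {ρ : Setoid V}
    (f : ℕ → ℕ) (hρ : ρ = Setoid.ker fun v => f (lab v))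
    (hinj : Function.Injective lab) (hsurj : ∀ m ≤ 2 * k, ∃ v, lab v = m)
    (hle : ∀ v, lab v ≤ 2 * k + 1) (hm : 1 ≤ m) (hmk : m + 1 ≤ 2 * k)
    (hmono : ∀ x y, x ≤ y → y ≤ 2 * k → f x ≤ f y)
    (hedge : f m = f (m + 1)) (hgap : f (m + 1) < f (m + 2) ∨ m + 1 = 2 * k)
    (hfib : ∀ x ≤ 2 * k, ∀ y ≤ 2 * k, x % 2 = y % 2 → f x = f y → x = y) :
    block {v | lab v ≤ m} ⊔ ((block {v | lab v ≤ m} ⊔ ρ) ⊓ parityRel k lab) =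
      block {v | lab v ≤ m + 1} := by
  subst hρ
  refine le_antisymm (sup_le (block_mono fun v hv => Nat.le_succ_of_le hv) ?_) ?_
  · have hW : block {v | lab v ≤ m} ⊔ (Setoid.ker fun v => f (lab v)) ≤
        Setoid.ker fun v => max (f (lab v)) (f m) := by
      refine sup_le (block_le.2 fun x hx y hy => ?_) fun x y hxy => ?_
      · have h1 := hmono _ _ hx (by omega)
        have h2 := hmono _ _ hy (by omega)
        simp only [Setoid.ker_def]
        omega
      · have hxy : f (lab x) = f (lab y) := hxy
        simp only [Setoid.ker_def, hxy]
    rintro x y ⟨hxy, ha⟩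
    have hxy : max (f (lab x)) (f m) = max (f (lab y)) (f m) := hW hxy
    replace ha := parityRel_rel.1 ha
    have hx := hle x
    have hy := hle y
    by_cases hne : lab x = lab y
    · exact Or.inl (hinj hne)
    have hx' : lab x ≤ 2 * k := by split_ifs at ha <;> omega
    have hy' : lab y ≤ 2 * k := by split_ifs at ha <;> omega
    have hpar : lab x % 2 = lab y % 2 := by split_ifs at ha <;> omega
    have key : ∀ z ≤ 2 * k, f z ≤ f m → z ≤ m + 1 := by
      intro z hz hzm
      by_contra hcon
      have := hmono (m + 2) z (by omega) hz
      omega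
    have hfx : f (lab x) ≠ f (lab y) := fun h => hne (hfib _ hx' _ hy' hpar h)
    exact Or.inr ⟨key _ hx' (by omega), key _ hy' (by omega)⟩
  · obtain ⟨u, hu⟩ := hsurj (m - 1) (by omega)
    obtain ⟨v, hv⟩ := hsurj m (by omega)
    obtain ⟨w, hw⟩ := hsurj (m + 1) hmk
    have huw : block {u, w} ≤ (block {v | lab v ≤ m} ⊔ Setoid.ker fun v => f (lab v)) ⊓
        parityRel k lab := by
      refine block_pair_le.2 ⟨Setoid.trans' _ (y := v) ?_ ?_, ?_⟩
      · exact (le_sup_left : block {v | lab v ≤ m} ≤ _)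
          (Or.inr ⟨by simp only [Set.mem_ofPred_eq]; omega, by simp only [Set.mem_ofPred_eq]; omega⟩)
      · refine (le_sup_right : (Setoid.ker fun v => f (lab v)) ≤ _) ?_
        simp only [Setoid.ker_def, hv, hw, hedge]
      · rw [parityRel_rel]
        split_ifs <;> omega
    refine le_trans ?_ (sup_le_sup_left huw _)
    rw [block_sup ⟨u, by simp only [Set.mem_ofPred_eq]; omega, by simp⟩]
    refine block_mono fun x hx => ?_
    simp only [Set.mem_ofPred_eq, Set.mem_union, Set.mem_insert_iff, Set.mem_singleton_iff] at hx ⊢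
    by_cases hxm : lab x ≤ m
    · exact Or.inl hxm
    · exact Or.inr (Or.inr (hinj (by omega)))

theorem block_final_pred {k m : ℕ} {lab : V → ℕ} {ρ : Setoid V}
    (f : ℕ → ℕ) (hρ : ρ = Setoid.ker fun v => f (lab v))
    (hinj : Function.Injective lab) (hsurj : ∀ m ≤ 2 * k, ∃ v, lab v = m)
    (hle : ∀ v, lab v ≤ 2 * k + 1) (hmk : m + 2 ≤ 2 * k)
    (hmono : ∀ x y, x ≤ y → y ≤ 2 * k → f x ≤ f y)
    (hedge : f m = f (m + 1)) (hgap : ∀ x < m, f x < f m)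
    (hfib : ∀ x ≤ 2 * k, ∀ y ≤ 2 * k, x % 2 = y % 2 → f x = f y → x = y) :
    block {v | m + 1 ≤ lab v ∧ lab v ≤ 2 * k} ⊔
        ((block {v | m + 1 ≤ lab v ∧ lab v ≤ 2 * k} ⊔ ρ) ⊓ parityRel k lab) =
      block {v | m ≤ lab v ∧ lab v ≤ 2 * k} := by
  subst hρ
  refine le_antisymm (sup_le (block_mono fun v hv => ⟨Nat.le_of_succ_le hv.1, hv.2⟩) ?_) ?_
  · have hW : block {v | m + 1 ≤ lab v ∧ lab v ≤ 2 * k} ⊔ (Setoid.ker fun v => f (lab v)) ≤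
        Setoid.ker fun v => min (f (lab v)) (f m) := by
      refine sup_le (block_le.2 fun x hx y hy => ?_) fun x y hxy => ?_
      · have h1 := hmono _ _ hx.1 hx.2
        have h2 := hmono _ _ hy.1 hy.2
        simp only [Setoid.ker_def]
        omega
      · have hxy : f (lab x) = f (lab y) := hxy
        simp only [Setoid.ker_def, hxy]
    rintro x y ⟨hxy, ha⟩
    have hxy : min (f (lab x)) (f m) = min (f (lab y)) (f m) := hW hxy
    replace ha := parityRel_rel.1 ha
    have hx := hle x
    have hy := hle y
    by_cases hne : lab x = lab y
    · exact Or.inl (hinj hne)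
    have hx' : lab x ≤ 2 * k := by split_ifs at ha <;> omega
    have hy' : lab y ≤ 2 * k := by split_ifs at ha <;> omega
    have hpar : lab x % 2 = lab y % 2 := by split_ifs at ha <;> omega
    have key : ∀ z, f m ≤ f z → m ≤ z := by
      intro z hzm
      by_contra hcon
      have := hgap z (by omega)
      omega
    have hfx : f (lab x) ≠ f (lab y) := fun h => hne (hfib _ hx' _ hy' hpar h)
    exact Or.inr ⟨⟨key _ (by omega), hx'⟩, ⟨key _ (by omega), hy'⟩⟩
  · obtain ⟨u, hu⟩ := hsurj (m + 2) (by omega)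
    obtain ⟨v, hv⟩ := hsurj (m + 1) (by omega)
    obtain ⟨w, hw⟩ := hsurj m (by omega)
    have huw : block {u, w} ≤ (block {v | m + 1 ≤ lab v ∧ lab v ≤ 2 * k} ⊔
        Setoid.ker fun v => f (lab v)) ⊓ parityRel k lab := by
      refine block_pair_le.2 ⟨Setoid.trans' _ (y := v) ?_ ?_, ?_⟩
      · exact (le_sup_left : block {v | m + 1 ≤ lab v ∧ lab v ≤ 2 * k} ≤ _)
          (Or.inr ⟨by simp only [Set.mem_ofPred_eq]; omega, by simp only [Set.mem_ofPred_eq]; omega⟩)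
      · refine (le_sup_right : (Setoid.ker fun v => f (lab v)) ≤ _) ?_
        simp only [Setoid.ker_def, hv, hw, hedge]
      · rw [parityRel_rel]
        split_ifs <;> omega
    refine le_trans ?_ (sup_le_sup_left huw _)
    rw [block_sup ⟨u, by simp only [Set.mem_ofPred_eq]; omega, by simp⟩]
    refine block_mono fun x hx => ?_
    simp only [Set.mem_ofPred_eq, Set.mem_union, Set.mem_insert_iff, Set.mem_singleton_iff] at hx ⊢
    by_cases hxm : m + 1 ≤ lab x
    · exact Or.inl ⟨hxm, hx.2⟩
    · exact Or.inr (Or.inr (hinj (by omega)))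

section Generation

variable {k i j : ℕ} {lab : V → ℕ} {S : Set (Setoid V)}

theorem block_initial_mem (hS : IsSublattice S) (hinj : Function.Injective lab)
    (hsurj : ∀ m ≤ 2 * k, ∃ v, lab v = m) (hle : ∀ v, lab v ≤ 2 * k + 1)
    (ha : parityRel k lab ∈ S) (hb : evenMatch k i lab ∈ S) (hg : oddMatch k j lab ∈ S)
    (h0 : block {v | lab v ≤ 1} ∈ S) (m : ℕ) (hm : 1 ≤ m) (hmk : m ≤ 2 * k) :
    block {v | lab v ≤ m} ∈ S := by
  induction m, hm using Nat.le_induction with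
  | base => exact h0
  | succ m hm ih =>
    have ih := ih (by omega)
    rcases Nat.even_or_odd' m with ⟨l, rfl | rfl⟩
    · rw [← block_initial_succ (fun x => if x = 2 * k + 1 then i else x / 2) rfl
        hinj hsurj hle hm hmk]
      · exact hS.supClosed ih (hS.infClosed (hS.supClosed ih hb) ha)
      · intro x y hxy hy
        split_ifs <;> omega
      · split_ifs <;> omega
      · split_ifs <;> omega
      · intro x hx y hy hpar hxy
        split_ifs at hxy <;> omega
    · rw [← block_initial_succ (fun x => if x = 2 * k + 1 then j + 1 else (x + 1) / 2) rfl
        hinj hsurj hle hm hmk]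
      · exact hS.supClosed ih (hS.infClosed (hS.supClosed ih hg) ha)
      · intro x y hxy hy
        split_ifs <;> omega
      · split_ifs <;> omega
      · split_ifs <;> omega
      · intro x hx y hy hpar hxy
        split_ifs at hxy <;> omega

theorem block_final_mem (hS : IsSublattice S) (hinj : Function.Injective lab)
    (hsurj : ∀ m ≤ 2 * k, ∃ v, lab v = m) (hle : ∀ v, lab v ≤ 2 * k + 1)
    (ha : parityRel k lab ∈ S) (hb : evenMatch k i lab ∈ S) (hg : oddMatch k j lab ∈ S)
    (h1 : block {v | 2 * k - 1 ≤ lab v ∧ lab v ≤ 2 * k} ∈ S) (m : ℕ) (hmk : m + 1 ≤ 2 * k) :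
    block {v | m ≤ lab v ∧ lab v ≤ 2 * k} ∈ S := by
  refine Nat.decreasingInduction' (P := fun m => block {v | m ≤ lab v ∧ lab v ≤ 2 * k} ∈ S)
    (m := m) (n := 2 * k - 1) (fun m hm _ ih => ?_) (by omega) h1
  rcases Nat.even_or_odd' m with ⟨l, rfl | rfl⟩
  · rw [← block_final_pred (fun x => if x = 2 * k + 1 then i else x / 2) rfl
      hinj hsurj hle (by omega)]
    · exact hS.supClosed ih (hS.infClosed (hS.supClosed ih hb) ha)
    · intro x y hxy hy
      split_ifs <;> omega
    · split_ifs <;> omega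
    · intro x hx
      split_ifs <;> omega
    · intro x hx y hy hpar hxy
      split_ifs at hxy <;> omega
  · rw [← block_final_pred (fun x => if x = 2 * k + 1 then j + 1 else (x + 1) / 2) rfl
      hinj hsurj hle (by omega)]
    · exact hS.supClosed ih (hS.infClosed (hS.supClosed ih hg) ha)
    · intro x y hxy hy
      split_ifs <;> omega
    · split_ifs <;> omega
    · intro x hx
      split_ifs <;> omega
    · intro x hx y hy hpar hxy
      split_ifs at hxy <;> omega

theorem block_pair_mem_of_lt (hS : IsSublattice S) (hinj : Function.Injective lab)
    (hsurj : ∀ m ≤ 2 * k, ∃ v, lab v = m) (hle : ∀ v, lab v ≤ 2 * k + 1)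
    (ha : parityRel k lab ∈ S) (hb : evenMatch k i lab ∈ S) (hg : oddMatch k j lab ∈ S)
    (h0 : block {v | lab v ≤ 1} ∈ S)
    (h1 : block {v | 2 * k - 1 ≤ lab v ∧ lab v ≤ 2 * k} ∈ S) :
    ∀ x y : V, lab x < lab y → lab y ≤ 2 * k → block {x, y} ∈ S := by
  have hI := block_initial_mem hS hinj hsurj hle ha hb hg h0
  have hF := block_final_mem hS hinj hsurj hle ha hb hg h1
  have hIF : ∀ l m, 1 ≤ m → m ≤ 2 * k → l + 1 ≤ 2 * k →
      block {v | l ≤ lab v ∧ lab v ≤ m} ∈ S := by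
    intro l m hm hmk hl
    have := hS.infClosed (hF l hl) (hI m hm hmk)
    rw [block_inf] at this
    convert this using 2
    ext v
    simp only [Set.mem_ofPred_eq, Set.mem_inter_iff]
    omega
  suffices ∀ d x y, lab y = lab x + d → 0 < d → lab y ≤ 2 * k → block {x, y} ∈ S from
    fun x y hxy hy => this (lab y - lab x) x y (by omega) (by omega) hy
  intro d
  induction d using Nat.strong_induction_on with
  | _ d ih =>
    intro x y hxy hd hy
    obtain rfl | rfl | hd3 : d = 1 ∨ d = 2 ∨ 3 ≤ d := by omega
    · convert hIF (lab x) (lab y) (by omega) hy (by omega) using 2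
      ext v
      simp only [Set.mem_insert_iff, Set.mem_singleton_iff, Set.mem_ofPred_eq, ← hinj.eq_iff (b := x),
        ← hinj.eq_iff (b := y)]
      omega
    · convert hS.infClosed (hIF (lab x) (lab y) (by omega) hy (by omega)) ha using 1
      refine le_antisymm (block_pair_le.2 ⟨Or.inr ⟨?_, ?_⟩, ?_⟩) ?_
      · simp only [Set.mem_ofPred_eq]; omega
      · simp only [Set.mem_ofPred_eq]; omega
      · rw [parityRel_rel]
        split_ifs <;> omega
      · rintro u v ⟨huv | ⟨hu, hv⟩, hpar⟩
        · exact Or.inl huv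
        · by_cases huv : lab u = lab v
          · exact Or.inl (hinj huv)
          replace hpar := parityRel_rel.1 hpar
          simp only [Set.mem_ofPred_eq] at hu hv
          refine Or.inr ?_
          simp only [Set.mem_insert_iff, Set.mem_singleton_iff, ← hinj.eq_iff (b := x),
            ← hinj.eq_iff (b := y)]
          split_ifs at hpar <;> omega
    · obtain ⟨u, hu⟩ := hsurj (lab x + 1) (by omega)
      obtain ⟨v, hv⟩ := hsurj (lab x + 2) (by omega)
      refine block_pair_mem_of_quadrangle hS (y := u) (w := v) ?_ ?_ ?_ ?_ ?_
      · rintro rfl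
        omega
      · exact ih 1 (by omega) _ _ (by omega) (by omega) (by omega)
      · exact ih (d - 1) (by omega) _ _ (by omega) (by omega) (by omega)
      · exact ih 2 (by omega) _ _ (by omega) (by omega) (by omega)
      · exact ih (d - 2) (by omega) _ _ (by omega) (by omega) (by omega)

theorem block_pair_mem (hS : IsSublattice S) (hinj : Function.Injective lab)
    (hsurj : ∀ m ≤ 2 * k, ∃ v, lab v = m) (hle : ∀ v, lab v ≤ 2 * k + 1)
    (hij : i < j) (hj : j < k)
    (hb : evenMatch k i lab ∈ S) (hg : oddMatch k j lab ∈ S)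
    (hlt : ∀ x y : V, lab x < lab y → lab y ≤ 2 * k → block {x, y} ∈ S) :
    ∀ x y : V, x ≠ y → block {x, y} ∈ S := by
  have hU : ∀ x y : V, x ≠ y → lab x ≤ 2 * k → lab y ≤ 2 * k → block {x, y} ∈ S := by
    intro x y hxy hx hy
    rcases lt_or_gt_of_ne (hinj.ne hxy) with h | h
    · exact hlt x y h hy
    · rw [Set.pair_comm]
      exact hlt y x h hx
  have hc : ∀ c x : V, lab c = 2 * k + 1 → lab x ≤ 2 * k → block {c, x} ∈ S := by
    intro c x hcl hx
    obtain ⟨u, hu⟩ := hsurj (2 * i) (by omega)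
    obtain ⟨v, hv⟩ := hsurj (2 * j + 1) (by omega)
    obtain ⟨w, hw⟩ := hsurj (2 * j + 2) (by omega)
    have huv : u ≠ v := by rintro rfl; omega
    have huw : u ≠ w := by rintro rfl; omega
    have hcu : block {c, u} ∈ S := by
      convert hS.infClosed (hS.supClosed hg (hU u v huv (by omega) (by omega))) hb using 1
      refine le_antisymm (block_pair_le.2 ⟨Setoid.trans' _ (y := v) ?_ ?_, ?_⟩) ?_
      · refine (le_sup_left : oddMatch k j lab ≤ _) (oddMatch_rel.2 ?_)
        split_ifs <;> omega
      · exact (le_sup_right : block {u, v} ≤ _) (Or.inr (by simp))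
      · rw [evenMatch_rel]
        split_ifs <;> omega
      · have hW : oddMatch k j lab ⊔ block {u, v} ≤ Setoid.ker fun z =>
            if (if lab z = 2 * k + 1 then j + 1 else (lab z + 1) / 2) = i then j + 1
            else (if lab z = 2 * k + 1 then j + 1 else (lab z + 1) / 2) := by
          refine sup_le (fun x y hxy => ?_) (block_pair_le.2 ?_)
          · have hxy := oddMatch_rel.1 hxy
            simp only [Setoid.ker_def, hxy]
          · simp only [Setoid.ker_def]
            split_ifs <;> omega
        rintro x y ⟨hxy, hbe⟩
        replace hxy := hW hxy
        replace hbe := evenMatch_rel.1 hbe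
        simp only [Setoid.ker_def] at hxy
        have hx := hle x
        have hy := hle y
        by_cases hne : lab x = lab y
        · exact Or.inl (hinj hne)
        refine Or.inr ?_
        simp only [Set.mem_insert_iff, Set.mem_singleton_iff, ← hinj.eq_iff (b := c),
            ← hinj.eq_iff (b := u)]
        split_ifs at hxy hbe <;> omega
    have hcw : block {c, w} ∈ S := by
      convert hS.infClosed (hS.supClosed hb (hU u w huw (by omega) (by omega))) hg using 1
      refine le_antisymm (block_pair_le.2 ⟨Setoid.trans' _ (y := u) ?_ ?_, ?_⟩) ?_
      · refine (le_sup_left : evenMatch k i lab ≤ _) (evenMatch_rel.2 ?_)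
        split_ifs <;> omega
      · exact (le_sup_right : block {u, w} ≤ _) (Or.inr (by simp))
      · rw [oddMatch_rel]
        split_ifs <;> omega
      · have hW : evenMatch k i lab ⊔ block {u, w} ≤ Setoid.ker fun z =>
            if (if lab z = 2 * k + 1 then i else lab z / 2) = j + 1 then i
            else (if lab z = 2 * k + 1 then i else lab z / 2) := by
          refine sup_le (fun x y hxy => ?_) (block_pair_le.2 ?_)
          · have hxy := evenMatch_rel.1 hxy
            simp only [Setoid.ker_def, hxy]
          · simp only [Setoid.ker_def]
            split_ifs <;> omega
        rintro x y ⟨hxy, hbe⟩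
        replace hxy := hW hxy
        replace hbe := oddMatch_rel.1 hbe
        simp only [Setoid.ker_def] at hxy
        have hx := hle x
        have hy := hle y
        by_cases hne : lab x = lab y
        · exact Or.inl (hinj hne)
        refine Or.inr ?_
        simp only [Set.mem_insert_iff, Set.mem_singleton_iff, ← hinj.eq_iff (b := c),
            ← hinj.eq_iff (b := w)]
        split_ifs at hxy hbe <;> omega
    by_cases hxu : x = u
    · rwa [hxu]
    by_cases hxw : x = w
    · rwa [hxw]
    exact block_pair_mem_of_quadrangle hS huw hcu (hU _ _ (Ne.symm hxu) (by omega) hx) hcw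
      (hU _ _ (Ne.symm hxw) (by omega) hx)
  intro x y hxy
  have hx := hle x
  have hy := hle y
  have hne := hinj.ne hxy
  by_cases hx' : lab x = 2 * k + 1
  · exact hc x y hx' (by omega)
  by_cases hy' : lab y = 2 * k + 1
  · rw [Set.pair_comm]
    exact hc y x hy' (by omega)
  exact hU x y hxy (by omega) (by omega)

theorem generate [Finite V] (hS : IsSublattice S) (hinj : Function.Injective lab)
    (hsurj : ∀ m ≤ 2 * k, ∃ v, lab v = m) (hle : ∀ v, lab v ≤ 2 * k + 1)
    (hij : i < j) (hj : j < k) {p : Setoid (Fin (k - 1))} {q : Setoid (Fin k)}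
    (ha : parityRel k lab ∈ S) (hb : evenMatch k i lab ∈ S) (hg : oddMatch k j lab ∈ S)
    (hd : linkRel k p q lab ∈ S) : S = Set.univ := by
  have h0 := hS.infClosed hd hb
  have h1 := hS.infClosed hd hg
  have hbot := hS.infClosed h0 h1
  rw [linkRel_inf_evenMatch hinj hle (by omega)] at h0 hbot
  rw [linkRel_inf_oddMatch hinj hle (by omega)] at h1 hbot
  rw [block_inf, block_subsingleton] at hbot
  · exact eq_univ_of_block_pair_mem hS hbot (block_pair_mem hS hinj hsurj hle hij hj hb hg
      (block_pair_mem_of_lt hS hinj hsurj hle ha hb hg h0 h1))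
  · rintro x ⟨hx, hx'⟩
    simp only [Set.mem_ofPred_eq] at hx hx'
    omega

end Generation

end Zigzag

section Recovery

variable {V : Type*} {k i j : ℕ} {lab : V → ℕ}

theorem parityRel_inf_evenMatch (hinj : Function.Injective lab)
    (hle : ∀ v, lab v ≤ 2 * k + 1) : parityRel k lab ⊓ evenMatch k i lab = ⊥ := by
  refine le_bot_iff.1 ?_
  rintro x y ⟨ha, hb⟩
  replace ha := parityRel_rel.1 ha
  replace hb := evenMatch_rel.1 hb
  have hx := hle x
  have hy := hle y
  refine hinj ?_
  split_ifs at ha hb <;> omega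

theorem evenMatch_inf_oddMatch (hinj : Function.Injective lab)
    (hle : ∀ v, lab v ≤ 2 * k + 1) (hij : i < j) :
    evenMatch k i lab ⊓ oddMatch k j lab = ⊥ := by
  refine le_bot_iff.1 ?_
  rintro x y ⟨hb, hg⟩
  replace hb := evenMatch_rel.1 hb
  replace hg := oddMatch_rel.1 hg
  have hx := hle x
  have hy := hle y
  refine hinj ?_
  split_ifs at hb hg <;> omega

theorem block_ne_bot {A : Set V} {x y : V} (hx : x ∈ A) (hy : y ∈ A) (hxy : x ≠ y) :
    block A ≠ ⊥ := by
  intro h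
  have h' : block A x y := Or.inr ⟨hx, hy⟩
  rw [h] at h'
  exact hxy h'

theorem evenMatch_inf_linkRel_ne_bot (hinj : Function.Injective lab)
    (hsurj : ∀ m ≤ 2 * k, ∃ v, lab v = m) (hle : ∀ v, lab v ≤ 2 * k + 1) (hk : 1 ≤ k)
    (p : Setoid (Fin (k - 1))) (q : Setoid (Fin k)) :
    evenMatch k i lab ⊓ linkRel k p q lab ≠ ⊥ := by
  rw [inf_comm, linkRel_inf_evenMatch hinj hle hk]
  obtain ⟨x, hx⟩ := hsurj 0 (by omega)
  obtain ⟨y, hy⟩ := hsurj 1 (by omega)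
  refine block_ne_bot (x := x) (y := y) ?_ ?_ ?_
  · simp only [Set.mem_ofPred_eq]; omega
  · simp only [Set.mem_ofPred_eq]; omega
  · rintro rfl
    omega

theorem oddMatch_inf_linkRel_ne_bot (hinj : Function.Injective lab)
    (hsurj : ∀ m ≤ 2 * k, ∃ v, lab v = m) (hle : ∀ v, lab v ≤ 2 * k + 1) (hk : 1 ≤ k)
    (p : Setoid (Fin (k - 1))) (q : Setoid (Fin k)) :
    oddMatch k j lab ⊓ linkRel k p q lab ≠ ⊥ := by
  rw [inf_comm, linkRel_inf_oddMatch hinj hle hk]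
  obtain ⟨x, hx⟩ := hsurj (2 * k - 1) (by omega)
  obtain ⟨y, hy⟩ := hsurj (2 * k) (by omega)
  refine block_ne_bot (x := x) (y := y) ?_ ?_ ?_
  · simp only [Set.mem_ofPred_eq]; omega
  · simp only [Set.mem_ofPred_eq]; omega
  · rintro rfl
    omega

theorem parityRel_ne_linkRel (hsurj : ∀ m ≤ 2 * k, ∃ v, lab v = m) (hk : 2 ≤ k)
    (p : Setoid (Fin (k - 1))) (q : Setoid (Fin k)) : parityRel k lab ≠ linkRel k p q lab := by
  intro h
  obtain ⟨x, hx⟩ := hsurj 0 (by omega)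
  obtain ⟨y, hy⟩ := hsurj 2 (by omega)
  have h1 : parityRel k lab x y := by
    rw [parityRel_rel]
    split_ifs <;> omega
  rw [h] at h1
  have := linkRel_tag h1
  split_ifs at this <;> omega

theorem evenMatch_ne_linkRel (hsurj : ∀ m ≤ 2 * k, ∃ v, lab v = m) (hk : 2 ≤ k)
    (p : Setoid (Fin (k - 1))) (q : Setoid (Fin k)) : evenMatch k i lab ≠ linkRel k p q lab := by
  intro h
  obtain ⟨x, hx⟩ := hsurj 2 (by omega)
  obtain ⟨y, hy⟩ := hsurj 3 (by omega)
  have h1 : evenMatch k i lab x y := by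
    rw [evenMatch_rel]
    split_ifs <;> omega
  rw [h] at h1
  have := linkRel_tag h1
  split_ifs at this <;> omega

theorem oddMatch_ne_linkRel (hsurj : ∀ m ≤ 2 * k, ∃ v, lab v = m) (hk : 2 ≤ k)
    (p : Setoid (Fin (k - 1))) (q : Setoid (Fin k)) : oddMatch k j lab ≠ linkRel k p q lab := by
  intro h
  obtain ⟨x, hx⟩ := hsurj 1 (by omega)
  obtain ⟨y, hy⟩ := hsurj 2 (by omega)
  have h1 : oddMatch k j lab x y := by
    rw [oddMatch_rel]
    split_ifs <;> omega
  rw [h] at h1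
  have := linkRel_tag h1
  split_ifs at this <;> omega

theorem evenMatch_ne_oddMatch (hsurj : ∀ m ≤ 2 * k, ∃ v, lab v = m) (hk : 1 ≤ k) :
    evenMatch k i lab ≠ oddMatch k j lab := by
  intro h
  obtain ⟨x, hx⟩ := hsurj 0 (by omega)
  obtain ⟨y, hy⟩ := hsurj 1 (by omega)
  have h1 : evenMatch k i lab x y := by
    rw [evenMatch_rel]
    split_ifs <;> omega
  rw [h] at h1
  replace h1 := oddMatch_rel.1 h1
  split_ifs at h1 <;> omega

/-- Some class of `r` has at least four elements. -/
def HasFourClass (r : Setoid V) : Prop :=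
  ∃ v : Fin 4 → V, Function.Injective v ∧ ∀ s t, r (v s) (v t)

theorem hasFourClass_parityRel (hsurj : ∀ m ≤ 2 * k, ∃ v, lab v = m) (hk : 3 ≤ k) :
    HasFourClass (parityRel k lab) := by
  choose v hv using fun s : Fin 4 => hsurj (2 * s) (by omega)
  refine ⟨v, fun s t hst => ?_, fun s t => ?_⟩
  · have := hv s
    rw [hst, hv t] at this
    omega
  · have h1 := hv s
    have h2 := hv t
    rw [parityRel_rel]
    split_ifs <;> omega

theorem not_hasFourClass_evenMatch (hinj : Function.Injective lab)
    (hle : ∀ v, lab v ≤ 2 * k + 1) : ¬ HasFourClass (evenMatch k i lab) := by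
  rintro ⟨v, hv, hr⟩
  have hne : ∀ s t : Fin 4, s ≠ t → lab (v s) ≠ lab (v t) := fun s t hst =>
    hinj.ne (hv.ne hst)
  have h01 := hne 0 1 (by decide)
  have h02 := hne 0 2 (by decide)
  have h03 := hne 0 3 (by decide)
  have h12 := hne 1 2 (by decide)
  have h13 := hne 1 3 (by decide)
  have h23 := hne 2 3 (by decide)
  have r1 := evenMatch_rel.1 (hr 0 1)
  have r2 := evenMatch_rel.1 (hr 0 2)
  have r3 := evenMatch_rel.1 (hr 0 3)
  have b0 := hle (v 0)
  have b1 := hle (v 1)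
  have b2 := hle (v 2)
  have b3 := hle (v 3)
  split_ifs at r1 r2 r3 <;> omega

theorem not_hasFourClass_oddMatch (hinj : Function.Injective lab)
    (hle : ∀ v, lab v ≤ 2 * k + 1) : ¬ HasFourClass (oddMatch k j lab) := by
  rintro ⟨v, hv, hr⟩
  have hne : ∀ s t : Fin 4, s ≠ t → lab (v s) ≠ lab (v t) := fun s t hst =>
    hinj.ne (hv.ne hst)
  have h01 := hne 0 1 (by decide)
  have h02 := hne 0 2 (by decide)
  have h03 := hne 0 3 (by decide)
  have h12 := hne 1 2 (by decide)
  have h13 := hne 1 3 (by decide)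
  have h23 := hne 2 3 (by decide)
  have r1 := oddMatch_rel.1 (hr 0 1)
  have r2 := oddMatch_rel.1 (hr 0 2)
  have r3 := oddMatch_rel.1 (hr 0 3)
  have b0 := hle (v 0)
  have b1 := hle (v 1)
  have b2 := hle (v 2)
  have b3 := hle (v 3)
  split_ifs at r1 r2 r3 <;> omega

theorem label_eq_top_of_parityRel_eq {lab' : V → ℕ} (hinj : Function.Injective lab)
    (hle : ∀ v, lab v ≤ 2 * k + 1) (hsurj' : ∀ m ≤ 2 * k, ∃ v, lab' v = m)
    (hle' : ∀ v, lab' v ≤ 2 * k + 1) (hk : 2 ≤ k)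
    (ha : parityRel k lab = parityRel k lab') (v : V) (hv : lab v = 2 * k + 1) :
    lab' v = 2 * k + 1 := by
  by_contra hne
  have hv' := hle' v
  obtain ⟨u, hu⟩ := hsurj' (if 2 ≤ lab' v then lab' v - 2 else lab' v + 2)
    (by split_ifs <;> omega)
  have h : parityRel k lab' v u := by
    rw [parityRel_rel]
    split_ifs at hu ⊢ <;> omega
  rw [← ha] at h
  replace h := parityRel_rel.1 h
  have hu' := hle u
  have : v = u := hinj (by split_ifs at h <;> omega)
  subst this
  split_ifs at hu <;> omega

theorem label_eq {lab' : V → ℕ} {i' j' : ℕ} (hinj : Function.Injective lab)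
    (hsurj : ∀ m ≤ 2 * k, ∃ v, lab v = m) (hle : ∀ v, lab v ≤ 2 * k + 1)
    (hinj' : Function.Injective lab') (hsurj' : ∀ m ≤ 2 * k, ∃ v, lab' v = m)
    (hle' : ∀ v, lab' v ≤ 2 * k + 1) (hk : 2 ≤ k) (hj' : j' < k)
    (ha : parityRel k lab = parityRel k lab') (hb : evenMatch k i lab = evenMatch k i' lab')
    (hg : oddMatch k j lab = oddMatch k j' lab') : lab = lab' := by
  have htop := label_eq_top_of_parityRel_eq hinj hle hsurj' hle' hk ha
  have htop' := label_eq_top_of_parityRel_eq hinj' hle' hsurj hle hk ha.symm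
  have key : ∀ m ≤ 2 * k, ∀ v, lab v = m → lab' v = m := by
    intro m
    induction m with
    | zero =>
      intro _ v hv
      by_contra hne
      have hv' := hle' v
      obtain ⟨u, hu⟩ := hsurj' (if lab' v = 2 * k + 1 then 2 * j' + 1 else
        if lab' v % 2 = 0 then lab' v - 1 else lab' v + 1) (by split_ifs <;> omega)
      have h : oddMatch k j' lab' v u := by
        rw [oddMatch_rel]
        split_ifs at hu ⊢ <;> omega
      rw [← hg] at h
      replace h := oddMatch_rel.1 h
      have hu' := hle u
      have : v = u := hinj (by split_ifs at h <;> omega)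
      subst this
      split_ifs at hu <;> omega
    | succ m ih =>
      intro hm v hv
      obtain ⟨u, hu⟩ := hsurj m (by omega)
      have hu' := ih (by omega) u hu
      have hne : lab' u ≠ lab' v := hinj'.ne (by rintro rfl; omega)
      have hv' := hle' v
      have hvt : lab' v ≠ 2 * k + 1 := fun h => by
        have := htop' v h
        omega
      rcases Nat.even_or_odd' m with ⟨l, rfl | rfl⟩
      · have h : evenMatch k i lab u v := by
          rw [evenMatch_rel]
          split_ifs <;> omega
        rw [hb] at h
        replace h := evenMatch_rel.1 h
        split_ifs at h <;> omega
      · have h : oddMatch k j lab u v := by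
          rw [oddMatch_rel]
          split_ifs <;> omega
        rw [hg] at h
        replace h := oddMatch_rel.1 h
        split_ifs at h <;> omega
  funext v
  have := hle v
  by_cases hv : lab v = 2 * k + 1
  · rw [hv, htop v hv]
  · exact (key _ (by omega) v rfl).symm

theorem attach_eq {i' j' : ℕ} (hsurj : ∀ m ≤ 2 * k + 1, ∃ v, lab v = m)
    (hi : i < k) (hj : j < k) (hb : evenMatch k i lab = evenMatch k i' lab)
    (hg : oddMatch k j lab = oddMatch k j' lab) : i = i' ∧ j = j' := by
  obtain ⟨c, hc⟩ := hsurj (2 * k + 1) le_rfl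
  obtain ⟨u, hu⟩ := hsurj (2 * i) (by omega)
  obtain ⟨v, hv⟩ := hsurj (2 * j + 1) (by omega)
  have h1 : evenMatch k i lab c u := by
    rw [evenMatch_rel]
    split_ifs <;> omega
  have h2 : oddMatch k j lab c v := by
    rw [oddMatch_rel]
    split_ifs <;> omega
  rw [hb] at h1
  rw [hg] at h2
  replace h1 := evenMatch_rel.1 h1
  replace h2 := oddMatch_rel.1 h2
  constructor
  · split_ifs at h1 <;> omega
  · split_ifs at h2 <;> omega

theorem linkRel_injective (hsurj : ∀ m ≤ 2 * k, ∃ v, lab v = m)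
    {p p' : Setoid (Fin (k - 1))} {q q' : Setoid (Fin k)}
    (h : linkRel k p q lab = linkRel k p' q' lab) : p = p' ∧ q = q' := by
  have : Nonempty V := ⟨(hsurj 0 (by omega)).choose⟩
  choose! z hz using hsurj
  have hp : ∀ (p : Setoid (Fin (k - 1))) (q : Setoid (Fin k)) (x y : Fin (k - 1)),
      linkRel k p q lab (z (2 * x + 2)) (z (2 * y + 2)) ↔ p x y := by
    intro p q x y
    rw [← classOf_eq, linkRel, Setoid.ker_def, hz _ (by omega), hz _ (by omega),
      if_neg (by omega), if_pos (by omega), if_neg (by omega), if_pos (by omega)]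
    simp
  have hq : ∀ (p : Setoid (Fin (k - 1))) (q : Setoid (Fin k)) (x y : Fin k),
      linkRel k p q lab (z (2 * x + 1)) (z (2 * y + 1)) ↔ q x y := by
    intro p q x y
    rw [← classOf_eq, linkRel, Setoid.ker_def, hz _ (by omega), hz _ (by omega),
      if_neg (by omega), if_neg (by omega), if_neg (by omega), if_neg (by omega)]
    have e : ∀ x : Fin k, min ((2 * (x : ℕ) + 1) / 2) (k - 1) = x := fun x => by omega
    simp [e]
  constructor
  · ext x y
    rw [← hp p q, h, hp]
  · ext x y
    rw [← hq p q, h, hq]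

end Recovery

/-- If the four roles in `{a t, b t, g t, d t}` can be recovered up to exchanging `b` and `g`,
then each four-element set of this form arises from at most two parameters. -/
theorem card_le_two_mul_card_image {T L : Type*} [Fintype T] [DecidableEq L] [Lattice L]
    [OrderBot L] (Q : L → Prop) (a b g d : T → L) (hQa : ∀ t, Q (a t)) (hQb : ∀ t, ¬ Q (b t))
    (hQg : ∀ t, ¬ Q (g t)) (hab : ∀ t, a t ⊓ b t = ⊥) (hbg : ∀ t, b t ⊓ g t = ⊥)
    (hbd : ∀ t, b t ⊓ d t ≠ ⊥) (hgd : ∀ t, g t ⊓ d t ≠ ⊥) (had' : ∀ t, a t ≠ d t)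
    (hbg' : ∀ t, b t ≠ g t) (hbd' : ∀ t, b t ≠ d t) (hgd' : ∀ t, g t ≠ d t)
    (hinj : ∀ s t, a s = a t → b s = b t → g s = g t → d s = d t → s = t) :
    Fintype.card T ≤
      2 * (Finset.univ.image fun t => ({a t, b t, g t, d t} : Finset L)).card := by
  have huniq : ∀ t, ∀ r ∈ ({a t, b t, g t, d t} : Finset L), r ≠ b t → r ⊓ b t ≠ ⊥ →
      r = d t := by
    intro t r hr hne hbot
    simp only [Finset.mem_insert, Finset.mem_singleton] at hr
    rcases hr with rfl | rfl | rfl | rfl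
    · exact absurd (hab t) hbot
    · exact absurd rfl hne
    · exact absurd (inf_comm (b t) (g t) ▸ hbg t) hbot
    · rfl
  refine Finset.card_le_mul_card_image _ 2 fun X hX => ?_
  obtain ⟨x, -, rfl⟩ := Finset.mem_image.1 hX
  refine (Finset.card_le_card_of_injOn b (t := {b x, g x}) ?_ ?_).trans Finset.card_le_two
  · intro y hy
    have hy : ({a y, b y, g y, d y} : Finset L) = {a x, b x, g x, d x} := by simpa using hy
    have hby : b y ∈ ({a x, b x, g x, d x} : Finset L) := by rw [← hy]; simp
    simp only [Finset.mem_insert, Finset.mem_singleton] at hby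
    simp only [Finset.coe_insert, Finset.coe_singleton, Set.mem_insert_iff,
      Set.mem_singleton_iff]
    rcases hby with h | h | h | h
    · exact absurd (h ▸ hQa x) (hQb y)
    · exact Or.inl h
    · exact Or.inr h
    · have h1 : b x = d y := huniq y _ (by rw [hy]; simp) (h ▸ hbd' x) (h ▸ hbd x)
      have h2 : g x = d y := huniq y _ (by rw [hy]; simp) (h ▸ hgd' x) (h ▸ hgd x)
      exact absurd (h1.trans h2.symm) (hbg' x)
  · intro y hy z hz hyz
    have hy : ({a y, b y, g y, d y} : Finset L) = {a x, b x, g x, d x} := by simpa using hy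
    have hz : ({a z, b z, g z, d z} : Finset L) = {a x, b x, g x, d x} := by simpa using hz
    have hyz' := hy.trans hz.symm
    have hd : d y = d z := by
      refine huniq z _ (by rw [← hyz']; simp) (hyz ▸ (hbd' y).symm) ?_
      rw [← hyz, inf_comm]
      exact hbd y
    have hg : g y = g z := by
      have h : g y ∈ ({a z, b z, g z, d z} : Finset L) := by rw [← hyz']; simp
      simp only [Finset.mem_insert, Finset.mem_singleton] at h
      rcases h with h | h | h | h
      · exact absurd (h ▸ hQa z) (hQg y)
      · exact absurd (hyz.trans h.symm) (hbg' y)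
      · exact h
      · exact absurd (h.trans hd.symm) (hgd' y)
    have ha : a y = a z := by
      have h : a y ∈ ({a z, b z, g z, d z} : Finset L) := by rw [← hyz']; simp
      simp only [Finset.mem_insert, Finset.mem_singleton] at h
      rcases h with h | h | h | h
      · exact h
      · exact absurd (h ▸ hQa y) (hQb z)
      · exact absurd (h ▸ hQa y) (hQg z)
      · exact absurd (h.trans hd.symm) (had' y)
    exact hinj y z ha hyz hg hd

theorem card_mul_bell_le {n k : ℕ} (hk : 3 ≤ k) (hn : 2 * k + 1 ≤ n) (hn' : n ≤ 2 * k + 2)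
    (I : Finset (ℕ × ℕ)) (hI : ∀ e ∈ I, e.1 < e.2 ∧ e.2 < k)
    (hodd : n = 2 * k + 1 → I.card ≤ 1) :
    n.factorial * I.card * bell (k - 1) * bell k ≤ 2 * numGen n := by
  classical
  let _ (m : ℕ) : Fintype (Setoid (Fin m)) :=
    Fintype.ofInjective (fun r : Setoid (Fin m) => fun x y => r x y) fun r s h =>
      Setoid.ext fun x y => iff_of_eq (congrFun (congrFun h x) y)
  let lab (σ : Equiv.Perm (Fin n)) (v : Fin n) : ℕ := σ v
  have hinj : ∀ σ, Function.Injective (lab σ) := fun σ =>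
    Fin.val_injective.comp σ.injective
  have hsurj : ∀ σ, ∀ m < n, ∃ v, lab σ v = m := fun σ m hm => ⟨σ.symm ⟨m, hm⟩, by simp [lab]⟩
  have hsurj' : ∀ σ, ∀ m ≤ 2 * k, ∃ v, lab σ v = m := fun σ m hm => hsurj σ m (by omega)
  have hle : ∀ σ v, lab σ v ≤ 2 * k + 1 := fun σ v => by
    have := (σ v).isLt
    simp only [lab]
    omega
  let T := Equiv.Perm (Fin n) × I × Setoid (Fin (k - 1)) × Setoid (Fin k)
  let a (t : T) : Setoid (Fin n) := parityRel k (lab t.1)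
  let b (t : T) : Setoid (Fin n) := evenMatch k t.2.1.1.1 (lab t.1)
  let g (t : T) : Setoid (Fin n) := oddMatch k t.2.1.1.2 (lab t.1)
  let d (t : T) : Setoid (Fin n) := linkRel k t.2.2.1 t.2.2.2 (lab t.1)
  have hlt (t : T) := hI _ t.2.1.2
  have hQa (t : T) : HasFourClass (a t) := hasFourClass_parityRel (hsurj' _) hk
  have hQb (t : T) : ¬ HasFourClass (b t) := not_hasFourClass_evenMatch (hinj _) (hle _)
  have hQg (t : T) : ¬ HasFourClass (g t) := not_hasFourClass_oddMatch (hinj _) (hle _)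
  have hbg (t : T) : b t ≠ g t := evenMatch_ne_oddMatch (hsurj' _) (by omega)
  have had (t : T) : a t ≠ d t := parityRel_ne_linkRel (hsurj' _) (by omega) _ _
  have hbd (t : T) : b t ≠ d t := evenMatch_ne_linkRel (hsurj' _) (by omega) _ _
  have hgd (t : T) : g t ≠ d t := oddMatch_ne_linkRel (hsurj' _) (by omega) _ _
  have hcard : Fintype.card T = n.factorial * I.card * bell (k - 1) * bell k := by
    simp only [T, Fintype.card_prod, Fintype.card_perm, Fintype.card_fin, Fintype.card_coe, bell,
      Nat.card_eq_fintype_card]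
    ring
  rw [← hcard]
  refine (card_le_two_mul_card_image HasFourClass a b g d hQa hQb hQg
    (fun t => parityRel_inf_evenMatch (hinj _) (hle _))
    (fun t => evenMatch_inf_oddMatch (hinj _) (hle _) (hlt t).1)
    (fun t => evenMatch_inf_linkRel_ne_bot (hinj _) (hsurj' _) (hle _) (by omega) _ _)
    (fun t => oddMatch_inf_linkRel_ne_bot (hinj _) (hsurj' _) (hle _) (by omega) _ _)
    had hbg hbd hgd ?_).trans (Nat.mul_le_mul_left 2 ?_)
  · rintro ⟨σ, e, p, q⟩ ⟨σ', e', p', q'⟩ ha hb hg hd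
    have hlab : lab σ = lab σ' := label_eq (hinj _) (hsurj' _) (hle _) (hinj _) (hsurj' _) (hle _)
      (by omega) (hI _ e'.2).2 ha hb hg
    obtain rfl : σ = σ' := by
      ext v
      exact congrFun hlab v
    obtain ⟨rfl, rfl⟩ := linkRel_injective (hsurj' σ) hd
    have he : e = e' := by
      rcases Nat.lt_or_ge n (2 * k + 2) with h | h
      · exact Subtype.ext (Finset.card_le_one.1 (hodd (by omega)) _ e.2 _ e'.2)
      · have he := hI _ e.2
        have := attach_eq (fun m hm => hsurj σ m (by omega)) (he.1.trans he.2) he.2 hb hg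
        exact Subtype.ext (Prod.ext this.1 this.2)
    rw [he]
  · rw [numGen, Nat.card_eq_fintype_card, Fintype.card_subtype]
    refine Finset.card_le_card fun X hX => ?_
    obtain ⟨t, -, rfl⟩ := Finset.mem_image.1 hX
    simp only [Finset.mem_filter, Finset.mem_univ, true_and]
    constructor
    · have hab : a t ≠ b t := fun h => hQb t (h ▸ hQa t)
      have hag : a t ≠ g t := fun h => hQg t (h ▸ hQa t)
      exact Finset.card_eq_four.2 ⟨_, _, _, _, hab, hag, had t, hbg t, hbd t, hgd t, rfl⟩
    · refine generate (k := k) (lab := lab t.1) isSublattice_latticeClosure (hinj _) (hsurj' _)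
        (hle _) (hlt t).1 (hlt t).2 (p := t.2.2.1) (q := t.2.2.2)
        (subset_latticeClosure ?_) (subset_latticeClosure ?_) (subset_latticeClosure ?_)
        (subset_latticeClosure ?_)
      · exact Finset.mem_coe.2 (by simp [a])
      · exact Finset.mem_coe.2 (by simp [b])
      · exact Finset.mem_coe.2 (by simp [g])
      · exact Finset.mem_coe.2 (by simp [d])

theorem card_pairs_lt (k : ℕ) :
    ((Finset.range k ×ˢ Finset.range k).filter fun e : ℕ × ℕ => e.1 < e.2).card =
      k.choose 2 := by
  rw [Finset.card_filter, Finset.sum_product_right, Nat.choose_two_right, ← Finset.sum_range_id]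
  refine Finset.sum_congr rfl fun j hj => ?_
  rw [← Finset.card_filter, ← Finset.card_range j]
  congr 1
  ext i
  simp only [Finset.mem_filter, Finset.mem_range, Finset.card_range] at hj ⊢
  omega

end PartitionLattice

/-- For every `n ≥ 7`, the number `γ(n)` of four-element generating sets of `Part(n)`
satisfies `γ(n) ≥ (1/2) ⬝ n! ⬝ C(h(n), 2)^(e n) ⬝ B_(h(n)-1) ⬝ B_(h(n))`, where
`h(n) = ⌊(n-1)/2⌋` and `e(n)` is `0` for odd `n` and `1` for even `n`
(stated multiplied through by `2`). -/
theorem numGen_lower_bound (n : ℕ) (hn : 7 ≤ n) :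
    n.factorial * (Nat.choose ((n - 1) / 2) 2) ^ (if Odd n then 0 else 1)
        * bell ((n - 1) / 2 - 1) * bell ((n - 1) / 2)
      ≤ 2 * numGen n := by
  open PartitionLattice in
  rcases Nat.even_or_odd' n with ⟨k, hk | hk⟩
  · have hodd : ¬ Odd n := by rw [Nat.not_odd_iff_even]; exact ⟨k, by omega⟩
    have hh : (n - 1) / 2 = k - 1 := by omega
    rw [if_neg hodd, pow_one, hh, ← card_pairs_lt]
    refine card_mul_bell_le (by omega) (by omega) (by omega) _ ?_ (by omega)
    rintro ⟨i, j⟩ he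
    simp only [Finset.mem_filter, Finset.mem_product, Finset.mem_range] at he
    exact ⟨he.2, he.1.2⟩
  · have hodd : Odd n := ⟨k, hk⟩
    have hh : (n - 1) / 2 = k := by omega
    rw [if_pos hodd, pow_zero, hh]
    refine card_mul_bell_le (I := {(0, 1)}) (by omega) (by omega) (by omega) ?_ (by simp)
    simp only [Finset.mem_singleton]
    rintro e rfl
    exact ⟨one_pos, by omega⟩
end

section
/- Let d be an odd positive integer and let m_1 < m_2 < … < m_{d+2} be odd positive integers with d ≤ m_1 and m_1 ≥ 3. For i ∈ {1,…,d+2}, let w_i = C((m_i+3)/2, 2), and let p_i and q_i be nonnegative integers with p_i + q_i > 0 satisfying: either p_1 + q_1 = sba(d, m_1−1) or (p_1, q_1) ∈ tra(d, m_1−1); either p_2 + q_2 = sba(m_2−d, m_2−d−1) or (p_2, q_2) ∈ tra(m_2−d, m_2−d−1); and for each i ∈ {3,…,d+2}, either p_i + q_i = sba(d+3−i, m_i−d−1) or (p_i, q_i) ∈ tra(d+3−i, m_i−d−1). Then the direct product ∏_{i=1}^{d+2} ( Part(m_i+4)^{p_i} × Part(m_i+5)^{q_i·w_i} ) is a four-generated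 lattice. -/
/-- A lattice is *four-generated* if it has a four-element subset `X` such that the
smallest sublattice containing `X` (the closure of `X` under binary meets and joins)
is the whole lattice. -/
def FourGenerated (L : Type*) [Lattice L] : Prop :=
  ∃ X : Finset L, X.card = 4 ∧ latticeClosure (X : Set L) = Set.univ

/-- The *airiness* of a bit vector `x : Fin t → Bool`: the largest number `u` such that
`x` has `u` consecutive `false` (i.e. zero) entries. -/
noncomputable def air {t : ℕ} (x : Fin t → Bool) : ℕ :=
  sSup {u : ℕ | ∃ j : ℕ, j + u ≤ t ∧ ∀ i : Fin t, j ≤ i.val → i.val < j + u → x i = false}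

/-- `DBV u t`: the set of bit vectors of dimension `t` whose first coordinate is `1`
(`true`) and whose airiness is strictly less than `u`, ordered componentwise. -/
def DBV (u t : ℕ) : Set (Fin t → Bool) :=
  {x | (∀ i : Fin t, i.val = 0 → x i = true) ∧ air x < u}

/-- `sba u t`: the maximum size of an antichain in `DBV u t`. -/
noncomputable def sba (u t : ℕ) : ℕ :=
  sSup {n : ℕ | ∃ X : Finset (Fin t → Bool),
    ↑X ⊆ DBV u t ∧ IsAntichain (· ≤ ·) (X : Set (Fin t → Bool)) ∧ X.card = n}

/-- `tra u t`: the set of pairs `(|X|, |Y|)` where `X` and `Y` are antichains in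
`DBV u t` such that `x ≰ y` for all `x ∈ X` and `y ∈ Y`. -/
def tra (u t : ℕ) : Set (ℕ × ℕ) :=
  {p | ∃ X Y : Finset (Fin t → Bool),
    ↑X ⊆ DBV u t ∧ ↑Y ⊆ DBV u t ∧
    IsAntichain (· ≤ ·) (X : Set (Fin t → Bool)) ∧
    IsAntichain (· ≤ ·) (Y : Set (Fin t → Bool)) ∧
    (∀ x ∈ X, ∀ y ∈ Y, ¬ x ≤ y) ∧ p = (X.card, Y.card)}

/-- The kernel of a labelling `φ : ℕ → ℕ`, restricted to `Fin n`. -/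
def kerOn (n : ℕ) (φ : ℕ → ℕ) : Setoid (Fin n) := Setoid.ker fun x => φ x.val

/-- The labelling whose only identification is that of `a` and `b`. -/
def glue (a b : ℕ) : ℕ → ℕ := fun x => if x = b then a else x

/-- The labelling whose only identification is that of `a`, `b` and `c`. -/
def glueThree (a b c : ℕ) : ℕ → ℕ := fun x => if x = b ∨ x = c then a else x

lemma kerOn_inf {n : ℕ} {p q s : ℕ → ℕ}
    (h : ∀ x < n, ∀ y < n, p x = p y ∧ q x = q y ↔ s x = s y) :
    kerOn n p ⊓ kerOn n q = kerOn n s :=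
  Setoid.ext fun x y => h x x.2 y y.2

lemma kerOn_sup {n : ℕ} {p q s : ℕ → ℕ} (f : ℕ → ℕ)
    (hp : ∀ x < n, ∀ y < n, p x = p y → s x = s y)
    (hq : ∀ x < n, ∀ y < n, q x = q y → s x = s y)
    (hf : ∀ x < n, ∀ y < n, x ≠ y → s x = s y →
      f x < n ∧ f y < n ∧ p x = p (f x) ∧ p y = p (f y) ∧ q (f x) = q (f y)) :
    kerOn n p ⊔ kerOn n q = kerOn n s := by
  apply le_antisymm
  · exact sup_le (fun x y h => hp x x.2 y y.2 h) (fun x y h => hq x x.2 y y.2 h)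
  · intro x y h
    by_cases hxy : x = y
    · exact hxy ▸ Setoid.refl' _ _
    obtain ⟨hx, hy, h₁, h₂, h₃⟩ := hf x x.2 y y.2 (fun e => hxy (Fin.ext e)) h
    have hle : kerOn n p ≤ kerOn n p ⊔ kerOn n q := le_sup_left
    have hle' : kerOn n q ≤ kerOn n p ⊔ kerOn n q := le_sup_right
    have e₁ : (kerOn n p ⊔ kerOn n q) x ⟨f x, hx⟩ := hle h₁
    have e₂ : (kerOn n p ⊔ kerOn n q) ⟨f x, hx⟩ ⟨f y, hy⟩ := hle' h₃
    have e₃ : (kerOn n p ⊔ kerOn n q) y ⟨f y, hy⟩ := hle h₂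
    exact Setoid.trans' _ e₁ (Setoid.trans' _ e₂ (Setoid.symm' _ e₃))

lemma kerOn_glue_eq_bot {n a b : ℕ} (h : n ≤ b) : kerOn n (glue a b) = ⊥ := by
  refine Setoid.ext fun x y => ?_
  have hx := x.2
  have hy := y.2
  change glue a b x = glue a b y ↔ x = y
  rw [Fin.ext_iff]
  simp only [glue]
  split_ifs <;> omega

lemma kerOn_glue_comm (n a b : ℕ) : kerOn n (glue a b) = kerOn n (glue b a) := by
  refine Setoid.ext fun x y => ?_
  change glue a b x = glue a b y ↔ glue b a x = glue b a y
  simp only [glue]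
  split_ifs <;> omega

lemma kerOn_glue_le {n : ℕ} {a b : Fin n} {r : Setoid (Fin n)} (h : r a b) :
    kerOn n (glue a b) ≤ r := by
  intro x y hxy
  have hxy' : glue a b x = glue a b y := hxy
  have : x = y ∨ (x = a ∧ y = b) ∨ (x = b ∧ y = a) := by
    simp only [glue, Fin.ext_iff] at hxy' ⊢
    split_ifs at hxy' <;> omega
  rcases this with rfl | ⟨rfl, rfl⟩ | ⟨rfl, rfl⟩
  · exact Setoid.refl' _ _
  · exact h
  · exact Setoid.symm' _ h

lemma kerOn_glue_rel {n : ℕ} (a b : Fin n) : kerOn n (glue a b) a b := by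
  change glue a b a = glue a b b
  simp only [glue]
  split_ifs <;> rfl

lemma kerOn_glue_inf_eq_bot {n a b c : ℕ} (hab : a ≠ b) (hac : a ≠ c) (hbc : b ≠ c) :
    kerOn n (glue b c) ⊓ kerOn n (glue a c) = ⊥ := by
  refine Setoid.ext fun x y => ?_
  change glue b c x = glue b c y ∧ glue a c x = glue a c y ↔ x = y
  rw [Fin.ext_iff]
  simp only [glue]
  split_ifs <;> omega

section Generation

variable {ι : Type*} {n : ι → ℕ} {S : Set (∀ i, Setoid (Fin (n i)))}

/-- The family of kernels of the labellings `φ i` lies in `S`. -/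
def KerMem (S : Set (∀ i, Setoid (Fin (n i)))) (φ : ι → ℕ → ℕ) : Prop :=
  (fun i => kerOn (n i) (φ i)) ∈ S

lemma KerMem.inf (hS : IsSublattice S) {p q s : ι → ℕ → ℕ} (hp : KerMem S p) (hq : KerMem S q)
    (h : ∀ i, ∀ x < n i, ∀ y < n i, p i x = p i y ∧ q i x = q i y ↔ s i x = s i y) :
    KerMem S s := by
  have := hS.infClosed hp hq
  rwa [show ((fun i => kerOn (n i) (p i)) ⊓ fun i => kerOn (n i) (q i)) =
    fun i => kerOn (n i) (s i) from funext fun i => kerOn_inf (h i)] at this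

lemma KerMem.sup (hS : IsSublattice S) {p q s : ι → ℕ → ℕ} (hp : KerMem S p) (hq : KerMem S q)
    (f : ℕ → ℕ)
    (h₁ : ∀ i, ∀ x < n i, ∀ y < n i, p i x = p i y → s i x = s i y)
    (h₂ : ∀ i, ∀ x < n i, ∀ y < n i, q i x = q i y → s i x = s i y)
    (h₃ : ∀ i, ∀ x < n i, ∀ y < n i, x ≠ y → s i x = s i y →
      f x < n i ∧ f y < n i ∧ p i x = p i (f x) ∧ p i y = p i (f y) ∧
        q i (f x) = q i (f y)) :
    KerMem S s := by
  have := hS.supClosed hp hq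
  rwa [show ((fun i => kerOn (n i) (p i)) ⊔ fun i => kerOn (n i) (q i)) =
    fun i => kerOn (n i) (s i) from
      funext fun i => kerOn_sup f (h₁ i) (h₂ i) (h₃ i)] at this

lemma KerMem.glue_comm {a b : ℕ} (h : KerMem S fun _ => glue a b) :
    KerMem S fun _ => glue b a := by
  unfold KerMem at h ⊢
  simpa only [kerOn_glue_comm _ b a] using h

lemma KerMem.glue_three (hS : IsSublattice S) {a b c : ℕ} (hbc : b < c)
    (h₁ : KerMem S fun _ => glue a b) (h₂ : KerMem S fun _ => glue b c) :
    KerMem S fun _ => glueThree a b c := by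
  refine KerMem.sup hS h₁ h₂ (fun x => if x = a then b else x) ?_ ?_ ?_ <;>
  · intro i x hx y hy
    simp only [glue, glueThree]
    split_ifs <;> omega

lemma KerMem.glue_of_two (hS : IsSublattice S) {a b c v : ℕ}
    (hab : a ≠ b) (hav : a < v) (hbv : b < v) (hcv : c < v)
    (h₁ : KerMem S fun _ => glue c a) (h₂ : KerMem S fun _ => glue a v)
    (h₃ : KerMem S fun _ => glue c b) (h₄ : KerMem S fun _ => glue b v) :
    KerMem S fun _ => glue c v := by
  refine KerMem.inf hS (KerMem.glue_three hS hav h₁ h₂)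
    (KerMem.glue_three hS hbv h₃ h₄) ?_
  intro i x hx y hy
  simp only [glue, glueThree]
  split_ifs <;> omega

lemma KerMem.glue_zero_even (hS : IsSublattice S) (hα : KerMem S fun _ x => x % 2)
    (hγ : KerMem S fun _ x => (x + 1) / 2) {j : ℕ}
    (h : KerMem S fun _ => glue 0 (2 * j + 1)) : KerMem S fun _ => glue 0 (2 * j + 2) := by
  have key : KerMem S fun _ x => if x = 0 then j + 1 else (x + 1) / 2 := by
    refine KerMem.sup hS h hγ (fun x => if x = 0 then 2 * j + 1 else x) ?_ ?_ ?_ <;>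
    · intro i x hx y hy
      try simp only [glue]
      split_ifs <;> omega
  refine KerMem.inf hS key hα ?_
  intro i x hx y hy
  simp only [glue]
  split_ifs <;> omega

lemma KerMem.glue_pred_even (hS : IsSublattice S) (hγ : KerMem S fun _ x => (x + 1) / 2) {j : ℕ}
    (h : KerMem S fun _ => glue 0 (2 * j + 1)) (h' : KerMem S fun _ => glue 0 (2 * j + 2)) :
    KerMem S fun _ => glue (2 * j + 1) (2 * j + 2) := by
  refine KerMem.inf hS (KerMem.glue_three hS (by omega) h.glue_comm h') hγ ?_
  intro i x hx y hy
  simp only [glue, glueThree]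
  split_ifs <;> omega

/-- The labelling that identifies `2 * j` with `2 * l` and `2 * j + 1` with `2 * l + 1`. -/
def gluePair (l j : ℕ) : ℕ → ℕ :=
  fun x => if x = 2 * j then 2 * l else if x = 2 * j + 1 then 2 * l + 1 else x

lemma KerMem.glue_pair (hS : IsSublattice S) (hα : KerMem S fun _ x => x % 2)
    (hβ : KerMem S fun _ x => x / 2) {l j : ℕ} (hlj : l < j)
    (h : KerMem S fun _ => glue (2 * l + 1) (2 * j)) : KerMem S fun _ => gluePair l j := by
  have key : KerMem S fun _ x => if x / 2 = j then l else x / 2 := by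
    refine KerMem.sup hS hβ h
      (fun x => if x / 2 = l then 2 * l + 1 else 2 * (x / 2)) ?_ ?_ ?_ <;>
    · intro i x hx y hy
      try simp only [glue]
      split_ifs <;> omega
  refine KerMem.inf hS key hα ?_
  intro i x hx y hy
  simp only [gluePair]
  split_ifs <;> omega

lemma KerMem.glue_odd (hS : IsSublattice S) {j : ℕ} (hj : 2 ≤ j)
    (h₁₃ : KerMem S fun _ => glue 1 3) (h₀ : KerMem S fun _ => gluePair 0 j)
    (h₁ : KerMem S fun _ => gluePair 1 j) :
    (KerMem S fun _ => glue 1 (2 * j + 1)) ∧ KerMem S fun _ => glue 3 (2 * j + 1) := by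
  have k₀ : KerMem S fun _ x => if x = 2 * j then 0 else if x = 2 * j + 1 then 1 else
      if x = 3 then 1 else x := by
    refine KerMem.sup hS h₁₃ h₀ (fun x => if x = 3 then 1 else x) ?_ ?_ ?_ <;>
    · intro i x hx y hy
      simp only [glue, gluePair]
      grind
  have k₁ : KerMem S fun _ x => if x = 2 * j then 2 else if x = 2 * j + 1 then 1 else
      if x = 3 then 1 else x := by
    refine KerMem.sup hS h₁₃ h₁ (fun x => if x = 1 then 3 else x) ?_ ?_ ?_ <;>
    · intro i x hx y hy
      simp only [glue, gluePair]
      grind (splits := 30)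
  constructor
  · refine KerMem.inf hS h₀ k₁ ?_
    intro i x hx y hy
    simp only [glue, gluePair]
    grind
  · refine KerMem.inf hS h₁ k₀ ?_
    intro i x hx y hy
    simp only [glue, gluePair]
    grind

lemma KerMem.glue_all (hS : IsSublattice S) (hα : KerMem S fun _ x => x % 2)
    (hβ : KerMem S fun _ x => x / 2) (hγ : KerMem S fun _ x => (x + 1) / 2)
    (h₀₁ : KerMem S fun _ => glue 0 1) (h₁₃ : KerMem S fun _ => glue 1 3) :
    ∀ {a b : ℕ}, a ≠ b → KerMem S fun _ => glue a b := by
  have h₀₂ : KerMem S fun _ => glue 0 2 := KerMem.glue_zero_even (j := 0) hS hα hγ h₀₁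
  have h₁₂ : KerMem S fun _ => glue 1 2 := KerMem.glue_pred_even (j := 0) hS hγ h₀₁ h₀₂
  have h₂₃ : KerMem S fun _ => glue 2 3 := by
    refine KerMem.inf hS (KerMem.glue_three hS (by omega) h₁₂.glue_comm h₁₃) hβ ?_
    intro i x hx y hy
    simp only [glue, glueThree]
    split_ifs <;> omega
  have h₀₃ : KerMem S fun _ => glue 0 3 := KerMem.glue_of_two (a := 1) (b := 2) hS
    (by omega) (by omega) (by omega) (by omega) h₀₁ h₁₃ h₀₂ h₂₃
  have key : ∀ v, ∀ a < v, KerMem S fun _ => glue a v := by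
    intro v
    induction v using Nat.strong_induction_on with
    | _ v ih =>
      have sym : ∀ a < v, ∀ b < v, a ≠ b → KerMem S fun _ => glue a b := by
        intro a ha b hb hab
        rcases hab.lt_or_gt with h | h
        · exact ih b hb a h
        · exact (ih a ha b h).glue_comm
      have step : ∀ {a b}, a ≠ b → a < v → b < v → (KerMem S fun _ => glue a v) →
          (KerMem S fun _ => glue b v) → ∀ c < v, KerMem S fun _ => glue c v := by
        intro a b hab ha hb h h' c hc
        by_cases hca : c = a
        · exact hca ▸ h
        by_cases hcb : c = b
        · exact hcb ▸ h'
        exact KerMem.glue_of_two hS hab ha hb hc (sym c hc a ha hca) h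
          (sym c hc b hb hcb) h'
      rcases Nat.lt_or_ge v 4 with hv | hv
      · intro a ha
        interval_cases v <;> interval_cases a <;> assumption
      rcases Nat.even_or_odd' v with ⟨j, rfl | rfl⟩
      · obtain ⟨j, rfl⟩ : ∃ k, j = k + 1 := ⟨j - 1, by omega⟩
        have h := sym 0 (by omega) (2 * j + 1) (by omega) (by omega)
        have h' := KerMem.glue_zero_even hS hα hγ h
        exact step (a := 0) (b := 2 * j + 1) (by omega) (by omega) (by omega) h'
          (KerMem.glue_pred_even hS hγ h h')
      · have h := KerMem.glue_odd hS (j := j) (by omega) h₁₃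
          (KerMem.glue_pair hS hα hβ (by omega) (sym _ (by omega) _ (by omega) (by omega)))
          (KerMem.glue_pair hS hα hβ (by omega) (sym _ (by omega) _ (by omega) (by omega)))
        exact step (a := 1) (b := 3) (by omega) (by omega) (by omega) h.1 h.2
  intro a b hab
  rcases hab.lt_or_gt with h | h
  · exact key b a h
  · exact (key a b h).glue_comm

lemma KerMem.glue_one_three (hS : IsSublattice S) {c : ι → ℕ → ℕ}
    (hα : KerMem S fun _ x => x % 2) (hβ : KerMem S fun _ x => x / 2) (hδ : KerMem S c)
    (c₀₂ : ∀ i, c i 0 ≠ c i 2) (c₁₃ : ∀ i, c i 1 = c i 3)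
    (h₁₂ : KerMem S fun _ => glue 1 2) : KerMem S fun _ => glue 1 3 := by
  refine KerMem.inf hS (KerMem.glue_pair (l := 0) (j := 1) hS hα hβ (by omega) h₁₂) hδ ?_
  intro i x hx y hy
  have h := c₀₂ i
  have h' := c₁₃ i
  simp only [glue, gluePair]
  grind

lemma KerMem.glue_zero_one (hS : IsSublattice S) {c : ι → ℕ → ℕ}
    (hβ : KerMem S fun _ x => x / 2) (hδ : KerMem S c) (c₀₁ : ∀ i, c i 0 = c i 1)
    (hc : ∀ i k, 1 ≤ k → 2 * k + 1 < n i → c i (2 * k) ≠ c i (2 * k + 1)) :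
    KerMem S fun _ => glue 0 1 := by
  refine KerMem.inf hS hβ hδ ?_
  intro i x hx y hy
  have h := c₀₁ i
  have h₁ := hc i (x / 2)
  simp only [glue]
  rcases Nat.mod_two_eq_zero_or_one x with hx' | hx' <;>
  rcases Nat.mod_two_eq_zero_or_one y with hy' | hy' <;>
  grind

lemma exists_separating_move (hS : IsSublattice S)
    (hA : ∀ {a b : ℕ}, a ≠ b → KerMem S fun _ => glue a b) {i j : ι} {a b c : Fin (n i)}
    (hab : a ≠ b) (hac : a ≠ c) (hbc : b ≠ c)
    (h : ∃ x ∈ S, x i = kerOn (n i) (glue a b) ∧ x j = ⊥) :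
    ∃ x ∈ S, x i = kerOn (n i) (glue a c) ∧ x j = ⊥ := by
  obtain ⟨x, hx, hi, hj⟩ := h
  rw [ne_eq, Fin.ext_iff] at hab hac hbc
  refine ⟨_, hS.infClosed (hS.supClosed hx (hA hbc)) (hA hac), ?_, ?_⟩
  · refine inf_eq_right.2 (kerOn_glue_le ?_)
    have h₁ : kerOn (n i) (glue a b) ≤ x i ⊔ kerOn (n i) (glue b c) := hi ▸ le_sup_left
    have h₂ : kerOn (n i) (glue b c) ≤ x i ⊔ kerOn (n i) (glue b c) := le_sup_right
    exact Setoid.trans' _ (h₁ (kerOn_glue_rel a b)) (h₂ (kerOn_glue_rel b c))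
  · change (x j ⊔ kerOn (n j) (glue b c)) ⊓ kerOn (n j) (glue a c) = ⊥
    rw [hj, bot_sup_eq, kerOn_glue_inf_eq_bot hab hac hbc]

lemma exists_separating (hS : IsSublattice S)
    (hA : ∀ {a b : ℕ}, a ≠ b → KerMem S fun _ => glue a b) {i j : ι}
    (h : ∃ a b : Fin (n i), a ≠ b ∧ ∃ x ∈ S, x i = kerOn (n i) (glue a b) ∧ x j = ⊥)
    {a b : Fin (n i)} (hab : a ≠ b) :
    ∃ x ∈ S, x i = kerOn (n i) (glue a b) ∧ x j = ⊥ := by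
  obtain ⟨c, e, hce, h⟩ := h
  have comm : ∀ {a b : Fin (n i)}, (∃ x ∈ S, x i = kerOn (n i) (glue a b) ∧ x j = ⊥) →
      ∃ x ∈ S, x i = kerOn (n i) (glue b a) ∧ x j = ⊥ := by
    intro a b h
    rwa [kerOn_glue_comm]
  have first : ∀ v, c ≠ v → ∃ x ∈ S, x i = kerOn (n i) (glue c v) ∧ x j = ⊥ := by
    intro v hv
    by_cases hev : e = v
    · exact hev ▸ h
    · exact exists_separating_move hS hA hce hv hev h
  by_cases hca : c = a
  · exact hca ▸ first b (hca ▸ hab)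
  by_cases hcb : c = b
  · exact comm (hcb ▸ first a hca)
  exact exists_separating_move hS hA (Ne.symm hca) hab hcb (comm (first a hca))

lemma exists_isolated [Finite ι] (hS : IsSublattice S)
    (hA : ∀ {a b : ℕ}, a ≠ b → KerMem S fun _ => glue a b)
    (hsep : ∀ i j, i ≠ j →
      ∃ a b : Fin (n i), a ≠ b ∧ ∃ x ∈ S, x i = kerOn (n i) (glue a b) ∧ x j = ⊥)
    {i : ι} {a b : Fin (n i)} (hab : a ≠ b) :
    ∃ x ∈ S, x i = kerOn (n i) (glue a b) ∧ ∀ j, j ≠ i → x j = ⊥ := by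
  classical
  have := Fintype.ofFinite ι
  have key : ∀ s : Finset ι, ∃ x ∈ S, x i = kerOn (n i) (glue a b) ∧
      ∀ j ∈ s, j ≠ i → x j = ⊥ := by
    intro s
    induction s using Finset.induction_on with
    | empty => exact ⟨_, hA (Fin.val_ne_of_ne hab), rfl, by simp⟩
    | insert j s _ ih =>
      obtain ⟨x, hx, hxi, hxs⟩ := ih
      by_cases hji : j = i
      · exact ⟨x, hx, hxi, by grind⟩
      obtain ⟨y, hy, hyi, hyj⟩ := exists_separating hS hA (hsep i j (Ne.symm hji)) hab
      refine ⟨x ⊓ y, hS.infClosed hx hy, by simp [hxi, hyi], ?_⟩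
      intro k hk hki
      rcases Finset.mem_insert.1 hk with rfl | hk
      · simp [hyj]
      · simp [hxs k hk hki]
  obtain ⟨x, hx, hxi, h⟩ := key Finset.univ
  exact ⟨x, hx, hxi, fun j => h j (Finset.mem_univ j)⟩

lemma eq_univ_of_separating [Finite ι] (hS : IsSublattice S) (hbot : ⊥ ∈ S)
    (hA : ∀ {a b : ℕ}, a ≠ b → KerMem S fun _ => glue a b)
    (hsep : ∀ i j, i ≠ j →
      ∃ a b : Fin (n i), a ≠ b ∧ ∃ x ∈ S, x i = kerOn (n i) (glue a b) ∧ x j = ⊥) :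
    S = Set.univ := by
  classical
  have := Fintype.ofFinite ι
  have hiso : ∀ t : (i : ι) × (Fin (n i) × Fin (n i)), ∃ x ∈ S,
      x t.1 = kerOn (n t.1) (glue t.2.1 t.2.2) ∧ ∀ j, j ≠ t.1 → x j = ⊥ := by
    rintro ⟨i, a, b⟩
    by_cases hab : a = b
    · refine ⟨⊥, hbot, ?_, fun _ _ => rfl⟩
      exact (le_bot_iff.1 (kerOn_glue_le (hab ▸ Setoid.refl' _ _))).symm
    · exact exists_isolated hS hA hsep hab
  choose g hgS hgi hgj using hiso
  refine Set.eq_univ_of_forall fun x => ?_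
  have hx : x = (Finset.univ.filter fun t : (i : ι) × (Fin (n i) × Fin (n i)) =>
      x t.1 t.2.1 t.2.2).sup g := by
    apply le_antisymm
    · intro i a b h
      have ht : (⟨i, a, b⟩ : (i : ι) × (Fin (n i) × Fin (n i))) ∈
          Finset.univ.filter fun t => x t.1 t.2.1 t.2.2 := by simpa using h
      have hle := Finset.le_sup (f := g) ht i
      rw [hgi] at hle
      exact hle (kerOn_glue_rel a b)
    · refine Finset.sup_le fun t ht j => ?_
      by_cases hj : j = t.1
      · subst hj
        rw [hgi]
        exact kerOn_glue_le (Finset.mem_filter.1 ht).2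
      · rw [hgj t j hj]
        exact bot_le
  rw [hx]
  exact Finset.sup_induction hbot (fun a ha b hb => hS.supClosed ha hb) fun t _ => hgS t

/-- The four labellings whose kernels generate, for a family `c` of colorings. -/
def labelling (c : ι → ℕ → ℕ) : Fin 4 → ι → ℕ → ℕ :=
  ![fun _ x => x % 2, fun _ x => x / 2, fun _ x => (x + 1) / 2, c]

/-- The four generators. -/
def generator (n : ι → ℕ) (c : ι → ℕ → ℕ) (k : Fin 4) : ∀ i, Setoid (Fin (n i)) :=
  fun i => kerOn (n i) (labelling c k i)

lemma generator_injective [Nonempty ι] (hn : ∀ i, 4 ≤ n i) {c : ι → ℕ → ℕ}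
    (c₀₁ : ∀ i, c i 0 = c i 1) (c₁₃ : ∀ i, c i 1 = c i 3) (c₀₂ : ∀ i, c i 0 ≠ c i 2) :
    Function.Injective (generator n c) := by
  obtain ⟨i⟩ := ‹Nonempty ι›
  have hi := hn i
  have key : ∀ k l, generator n c k = generator n c l → ∀ x < 4, ∀ y < 4,
      labelling c k i x = labelling c k i y ↔ labelling c l i x = labelling c l i y := by
    intro k l h x hx y hy
    have := congrArg (fun r : Setoid (Fin (n i)) => r ⟨x, by omega⟩ ⟨y, by omega⟩)
      (congrFun h i)
    exact this.to_iff
  intro k l h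
  have h₀₁ := key k l h 0 (by omega) 1 (by omega)
  have h₀₂ := key k l h 0 (by omega) 2 (by omega)
  have h₁₃ := key k l h 1 (by omega) 3 (by omega)
  have e₁ := c₀₁ i
  have e₂ := c₁₃ i
  have e₃ := c₀₂ i
  fin_cases k <;> fin_cases l <;> simp_all [labelling]

theorem latticeClosure_generator [Finite ι] (hn : ∀ i, 4 ≤ n i) {c : ι → ℕ → ℕ}
    (c₀₁ : ∀ i, c i 0 = c i 1) (c₁₃ : ∀ i, c i 1 = c i 3) (c₀₂ : ∀ i, c i 0 ≠ c i 2)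
    (hc : ∀ i k, 1 ≤ k → 2 * k + 1 < n i → c i (2 * k) ≠ c i (2 * k + 1))
    (hsep : ∀ i j, i ≠ j → n i ≤ n j →
      ∃ a < n i, ∃ b < n i, c i a = c i b ∧ c j a ≠ c j b) :
    latticeClosure (Set.range (generator n c)) = Set.univ := by
  set S := latticeClosure (Set.range (generator n c)) with hS'
  have hS : IsSublattice S := isSublattice_latticeClosure
  have mem : ∀ k, KerMem S (labelling c k) := fun k =>
    subset_latticeClosure (Set.mem_range_self k)
  have hα : KerMem S fun _ x => x % 2 := mem 0
  have hβ : KerMem S fun _ x => x / 2 := mem 1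
  have hγ : KerMem S fun _ x => (x + 1) / 2 := mem 2
  have hδ : KerMem S c := mem 3
  have h₀₁ := KerMem.glue_zero_one hS hβ hδ c₀₁ hc
  have h₁₂ : KerMem S fun _ => glue 1 2 := KerMem.glue_pred_even (j := 0) hS hγ h₀₁
    (KerMem.glue_zero_even (j := 0) hS hα hγ h₀₁)
  have h₁₃ := KerMem.glue_one_three hS hα hβ hδ c₀₂ c₁₃ h₁₂
  have hA : ∀ {a b : ℕ}, a ≠ b → KerMem S fun _ => glue a b :=
    KerMem.glue_all hS hα hβ hγ h₀₁ h₁₃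
  refine eq_univ_of_separating hS ?_ hA ?_
  · have h : KerMem S fun _ x => x := KerMem.inf hS hα hβ (by intros; omega)
    rw [KerMem] at h
    convert h using 1
    funext i
    exact Setoid.ext fun x y => Fin.ext_iff
  · intro i j hij
    rcases Nat.lt_or_ge (n j) (n i) with h | h
    · have := hn i
      refine ⟨⟨0, by omega⟩, ⟨n i - 1, by omega⟩, ?_, _, hA (a := 0) (b := n i - 1) ?_, rfl,
        kerOn_glue_eq_bot ?_⟩
      · rw [ne_eq, Fin.mk.injEq]
        omega
      · omega
      · omega
    · obtain ⟨a, ha, b, hb, hi, hj⟩ := hsep i j hij h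
      have hab : a ≠ b := fun e => hj (e ▸ rfl)
      refine ⟨⟨a, ha⟩, ⟨b, hb⟩, ?_, _, hS.infClosed (hA hab) hδ, ?_, ?_⟩
      · rwa [ne_eq, Fin.mk.injEq]
      · exact inf_eq_left.2 (kerOn_glue_le (a := ⟨a, ha⟩) (b := ⟨b, hb⟩) hi)
      · refine Setoid.ext fun x y => ?_
        change glue a b x = glue a b y ∧ c j x = c j y ↔ x = y
        rw [Fin.ext_iff]
        simp only [glue]
        grind

end Generation

/-- A walk on the colors `0, …, e + 2` that rests exactly between the times `2 * K - 6` and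
`2 * K - 5`; its other steps are prescribed by `E`. -/
def walk (K e : ℕ) (E : ℕ → ℕ) : ℕ → ℕ
  | 0 => 3 * e
  | t + 1 => if t + 6 = 2 * K then walk K e E t else
      (walk K e E t + 1 + E (if t + 6 < 2 * K then t else t - 1)) % (3 + e)

/-- The coloring with initial values `0, 0, 1, 0, 2` that continues with a walk. -/
def coloring (K e : ℕ) (E : ℕ → ℕ) (x : ℕ) : ℕ :=
  if x = 2 then 1 else if x = 4 then 2 else if x < 4 then 0 else walk K e E (x - 5)

section Coloring

variable {K e : ℕ} {E : ℕ → ℕ}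

lemma walk_lt (he : e ≤ 1) (t : ℕ) : walk K e E t < 3 + e := by
  induction t with
  | zero => rw [walk]; omega
  | succ t ih =>
    rw [walk]
    split_ifs
    · exact ih
    · exact Nat.mod_lt _ (by omega)
    · exact Nat.mod_lt _ (by omega)

lemma walk_succ_ne (he : e ≤ 1) (hE : ∀ t, E t < 2 + e) {t : ℕ} (ht : t + 6 ≠ 2 * K) :
    walk K e E (t + 1) ≠ walk K e E t := by
  rw [walk, if_neg ht]
  have h₁ := walk_lt (K := K) (E := E) he t
  have h₂ := hE (if t + 6 < 2 * K then t else t - 1)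
  generalize E (if t + 6 < 2 * K then t else t - 1) = b at *
  interval_cases e <;> omega

lemma coloring_of_ge {x : ℕ} (hx : 5 ≤ x) : coloring K e E x = walk K e E (x - 5) := by
  rw [coloring, if_neg (by omega), if_neg (by omega), if_neg (by omega)]

lemma coloring_lt (he : e ≤ 1) (x : ℕ) : coloring K e E x < 3 + e := by
  have := walk_lt (K := K) (E := E) he (x - 5)
  rw [coloring]
  split_ifs <;> omega

lemma coloring_five : coloring K e E 5 = 3 * e := by
  rw [coloring_of_ge le_rfl, walk]

lemma coloring_marker (hK : 3 ≤ K) : coloring K e E (2 * K - 1) = coloring K e E (2 * K) := by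
  rw [coloring_of_ge (by omega), coloring_of_ge (by omega),
    show 2 * K - 1 - 5 = 2 * K - 6 by omega, show 2 * K - 5 = 2 * K - 6 + 1 by omega, walk,
    if_pos (by omega)]

lemma coloring_ne (he : e ≤ 1) (hE : ∀ t, E t < 2 + e) {x : ℕ} (hx : 5 ≤ x)
    (hxK : x + 1 ≠ 2 * K) : coloring K e E x ≠ coloring K e E (x + 1) := by
  rw [coloring_of_ge hx, coloring_of_ge (by omega), show x + 1 - 5 = x - 5 + 1 by omega]
  exact (walk_succ_ne he hE (by omega)).symm

lemma coloring_two_mul_ne (he : e ≤ 1) (hE : ∀ t, E t < 2 + e) {k : ℕ} (hk : 1 ≤ k) :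
    coloring K e E (2 * k) ≠ coloring K e E (2 * k + 1) := by
  rcases Nat.lt_or_ge k 3 with h | h
  · interval_cases k
    · simp [coloring]
    · rw [show 2 * 2 + 1 = 5 by rfl, coloring_five]
      simp only [coloring]
      norm_num
      omega
  · exact coloring_ne he hE (by omega) (by omega)

/-- A coloring is determined by its kernel. -/
lemma coloring_eq_of_imp {n : ℕ} {E' : ℕ → ℕ} (he : e ≤ 1) (hn : 6 ≤ n)
    (h : ∀ a < n, ∀ b < n, coloring K e E a = coloring K e E b →
      coloring K e E' a = coloring K e E' b) {x : ℕ} (hx : x < n) :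
    coloring K e E x = coloring K e E' x := by
  obtain ⟨a, ha, h₁, h₂⟩ : ∃ a < n, coloring K e E x = coloring K e E a ∧
      coloring K e E a = coloring K e E' a := by
    have hlt := coloring_lt (K := K) (E := E) he x
    have h₃ : coloring K e E x = 0 ∨ coloring K e E x = 1 ∨ coloring K e E x = 2 ∨
        coloring K e E x = 3 * e := by omega
    rcases h₃ with h₃ | h₃ | h₃ | h₃
    · exact ⟨0, by omega, by rw [h₃]; rfl, rfl⟩
    · exact ⟨2, by omega, by rw [h₃]; rfl, rfl⟩
    · exact ⟨4, by omega, by rw [h₃]; rfl, rfl⟩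
    · exact ⟨5, by omega, by rw [h₃, coloring_five], by rw [coloring_five, coloring_five]⟩
  rw [h₁, h₂]
  exact (h x hx a ha h₁).symm

lemma exists_coloring_separating {E' : ℕ → ℕ} (he : e ≤ 1) (hK : 3 ≤ K)
    (hE : ∀ t, E t < 2 + e) (hE' : ∀ t, E' t < 2 + e)
    (hne : ∃ t < 2 * K - 6 + e, E t ≠ E' t) :
    ∃ a < 2 * K + 1 + e, ∃ b < 2 * K + 1 + e,
      coloring K e E a = coloring K e E b ∧ coloring K e E' a ≠ coloring K e E' b := by
  by_contra! hcon
  have heq : ∀ t, t + 5 < 2 * K + 1 + e → walk K e E t = walk K e E' t := by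
    intro t ht
    have := coloring_eq_of_imp he (by omega) hcon ht
    rwa [coloring_of_ge (by omega), coloring_of_ge (by omega), Nat.add_sub_cancel] at this
  obtain ⟨t, ht, htE⟩ := hne
  apply htE
  obtain ⟨u, hu, huK, rfl⟩ : ∃ u, u + 6 < 2 * K + 1 + e ∧ u + 6 ≠ 2 * K ∧
      (if u + 6 < 2 * K then u else u - 1) = t := by
    by_cases h : t + 6 < 2 * K
    · exact ⟨t, by omega, by omega, by rw [if_pos h]⟩
    · exact ⟨t + 1, by omega, by omega, by rw [if_neg (by omega)]; rfl⟩
  have h₁ := heq (u + 1) (by omega)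
  rw [walk, walk, if_neg huK, if_neg huK, heq u (by omega)] at h₁
  have h₂ := walk_lt (K := K) (E := E') he u
  have h₃ := hE (if u + 6 < 2 * K then u else u - 1)
  have h₄ := hE' (if u + 6 < 2 * K then u else u - 1)
  generalize (if u + 6 < 2 * K then u else u - 1) = t at *
  interval_cases e <;> omega

end Coloring

theorem fourGenerated_pi {ι : Type*} [Finite ι] [Nonempty ι] {n K e : ι → ℕ} {E : ι → ℕ → ℕ}
    (hn : ∀ i, n i = 2 * K i + 1 + e i) (hK : ∀ i, 3 ≤ K i) (he : ∀ i, e i ≤ 1)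
    (hE : ∀ i t, E i t < 2 + e i)
    (hne : ∀ i j, i ≠ j → K i = K j → e i = e j → ∃ t < 2 * K i - 6 + e i, E i t ≠ E j t) :
    FourGenerated (∀ i, Setoid (Fin (n i))) := by
  classical
  have h4 : ∀ i, 4 ≤ n i := fun i => by have := hn i; have := hK i; omega
  let c : ι → ℕ → ℕ := fun i => coloring (K i) (e i) (E i)
  have inj : Function.Injective (generator n c) :=
    generator_injective h4 (fun _ => rfl) (fun _ => rfl) (fun _ => Nat.zero_ne_one)
  refine ⟨Finset.univ.image (generator n c), ?_, ?_⟩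
  · rw [Finset.card_image_of_injective _ inj]
    rfl
  · rw [Finset.coe_image, Finset.coe_univ, Set.image_univ]
    refine latticeClosure_generator h4 (fun _ => rfl) (fun _ => rfl)
      (fun _ => Nat.zero_ne_one)
      (fun i k hk _ => coloring_two_mul_ne (he i) (hE i) hk) fun i j hij hle => ?_
    have hi := hn i
    have hj := hn j
    have hKi := hK i
    have hKj := hK j
    have hei := he i
    have hej := he j
    rcases lt_trichotomy (K i) (K j) with h | h | h
    · refine ⟨2 * K i - 1, by omega, 2 * K i, by omega, coloring_marker hKi, ?_⟩
      have := coloring_ne (K := K j) (x := 2 * K i - 1) hej (hE j) (by omega) (by omega)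
      rwa [show 2 * K i - 1 + 1 = 2 * K i by omega] at this
    · by_cases h' : e i = e j
      · have hEj := hE j
        have hex := exists_coloring_separating hei hKi (hE i) (h' ▸ hEj) (hne i j hij h h')
        rw [← hi] at hex
        simpa only [c, ← h, ← h'] using hex
      · refine ⟨0, by omega, 5, by omega, ?_, ?_⟩
        · simp only [c, coloring_five]
          rw [show e i = 0 by omega]
          rfl
        · simp only [c, coloring_five]
          rw [show e j = 1 by omega]
          simp [coloring]
    · omega

lemma FourGenerated.of_bijective {L M : Type*} [Lattice L] [Lattice M] (h : FourGenerated L)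
    {f : L → M} (hf : Function.Bijective f) (hsup : ∀ a b, f (a ⊔ b) = f a ⊔ f b)
    (hinf : ∀ a b, f (a ⊓ b) = f a ⊓ f b) : FourGenerated M := by
  classical
  obtain ⟨X, hX, hcl⟩ := h
  refine ⟨X.image f, by rw [Finset.card_image_of_injective _ hf.1, hX], ?_⟩
  rw [Finset.coe_image, ← image_latticeClosure _ _ hsup hinf, hcl, Set.image_univ,
    hf.2.range_eq]

lemma exists_separated_labels {N r F : ℕ} (hr : 0 < r) (h : N ≤ r ^ F) :
    ∃ E : Fin N → ℕ → ℕ, (∀ a t, E a t < r) ∧ ∀ a b, a ≠ b → ∃ t < F, E a t ≠ E b t := by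
  obtain ⟨f⟩ : Nonempty (Fin N ↪ (Fin F → Fin r)) :=
    Function.Embedding.nonempty_of_card_le (by simpa using h)
  refine ⟨fun a t => if ht : t < F then f a ⟨t, ht⟩ else 0, fun a t => ?_, fun a b hab => ?_⟩
  · dsimp only
    split_ifs
    · exact Fin.is_lt _
    · exact hr
  · obtain ⟨t, ht⟩ := Function.ne_iff.1 (f.injective.ne hab)
    exact ⟨t, t.2, by simpa [Fin.ext_iff] using ht⟩

theorem fourGenerated_pi_prod {N : ℕ} {m K p q : Fin N → ℕ} (hm : ∀ i, m i + 3 = 2 * K i)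
    (hK : ∀ i, 3 ≤ K i) (hinj : Function.Injective K) (hp : ∀ i, p i ≤ 2 ^ (2 * K i - 6))
    (hq : ∀ i, q i ≤ 3 ^ (2 * K i - 5)) (hne : ∃ i, 0 < p i + q i) :
    FourGenerated (∀ i, (Fin (p i) → Setoid (Fin (m i + 4))) ×
      (Fin (q i) → Setoid (Fin (m i + 5)))) := by
  choose E₀ hE₀ hE₀' using fun i => exists_separated_labels (by omega) (hp i)
  choose E₁ hE₁ hE₁' using fun i => exists_separated_labels (by omega) (hq i)
  let ι := (i : Fin N) × (Fin (p i) ⊕ Fin (q i))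
  let n : ι → ℕ := fun x => x.2.elim (fun _ => m x.1 + 4) (fun _ => m x.1 + 5)
  let e : ι → ℕ := fun x => x.2.elim (fun _ => 0) (fun _ => 1)
  let E : ι → ℕ → ℕ := fun x => x.2.elim (E₀ x.1) (E₁ x.1)
  have : Nonempty ι := by
    obtain ⟨i, hi⟩ := hne
    rcases Nat.eq_zero_or_pos (p i) with h | h
    · exact ⟨⟨i, Sum.inr ⟨0, by omega⟩⟩⟩
    · exact ⟨⟨i, Sum.inl ⟨0, h⟩⟩⟩
  have key : FourGenerated (∀ x, Setoid (Fin (n x))) := by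
    refine fourGenerated_pi (K := fun x => K x.1) (e := e) (E := E) ?_ (fun x => hK x.1)
      ?_ ?_ ?_
    · rintro ⟨i, a | a⟩ <;>
      · have := hm i
        simp only [n, e, Sum.elim_inl, Sum.elim_inr]
        omega
    · rintro ⟨i, a | a⟩ <;> simp [e]
    · rintro ⟨i, a | a⟩ t
      · exact hE₀ i a t
      · exact hE₁ i a t
    · rintro ⟨i, a | a⟩ ⟨j, b | b⟩ hab hKij he
      · obtain rfl := hinj hKij
        exact hE₀' i a b fun h => hab (h ▸ rfl)
      · exact absurd he Nat.zero_ne_one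
      · exact absurd he Nat.one_ne_zero
      · obtain rfl := hinj hKij
        obtain ⟨t, ht, h⟩ := hE₁' i a b fun h => hab (h ▸ rfl)
        exact ⟨t, by simp only [e, Sum.elim_inr]; omega, h⟩
  refine key.of_bijective
    (f := fun F i => (fun a => F ⟨i, Sum.inl a⟩, fun a => F ⟨i, Sum.inr a⟩))
    ⟨fun F G h => ?_, fun G => ?_⟩ (fun _ _ => rfl) (fun _ _ => rfl)
  · funext ⟨i, a⟩
    have := congrFun h i
    rcases a with a | a
    · exact congrFun (congrArg Prod.fst this) a
    · exact congrFun (congrArg Prod.snd this) a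
  · refine ⟨fun x => match x with
      | ⟨i, Sum.inl a⟩ => (G i).1 a
      | ⟨i, Sum.inr a⟩ => (G i).2 a, rfl⟩

lemma card_le_of_isAntichain {u t : ℕ} {X : Finset (Fin t → Bool)} (hX : ↑X ⊆ DBV u t)
    (hanti : IsAntichain (· ≤ ·) (X : Set (Fin t → Bool))) : X.card ≤ 2 ^ (t - 2) := by
  have hinj : Set.InjOn (fun (x : Fin t → Bool) (i : Fin (t - 2)) => x ⟨i + 1, by omega⟩) X := by
    intro x hx y hy hxy
    by_contra hne
    obtain ⟨i, hi⟩ := Function.ne_iff.1 hne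
    have heq : ∀ j : Fin t, j.val + 1 < t → x j = y j := by
      intro j hj
      rcases Nat.eq_zero_or_pos j.val with h | h
      · rw [(hX hx).1 j h, (hX hy).1 j h]
      · have := congrFun hxy ⟨j - 1, by omega⟩
        simpa only [Nat.sub_add_cancel h] using this
    have hoff : ∀ j, j ≠ i → x j = y j := by
      intro j hj
      have : ¬ i.val + 1 < t := fun h => hi (heq i h)
      have := Fin.val_ne_of_ne hj
      exact heq j (by omega)
    rcases le_total (x i) (y i) with h | h
    · refine hanti hx hy hne fun j => ?_
      by_cases hj : j = i
      · exact hj ▸ h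
      · exact (hoff j hj).le
    · refine hanti hy hx (Ne.symm hne) fun j => ?_
      by_cases hj : j = i
      · exact hj ▸ h
      · exact (hoff j hj).ge
  calc X.card ≤ (Finset.univ : Finset (Fin (t - 2) → Bool)).card :=
        Finset.card_le_card_of_injOn _ (fun _ _ => Finset.mem_univ _) hinj
    _ = 2 ^ (t - 2) := by simp

lemma sba_le (u t : ℕ) : sba u t ≤ 2 ^ (t - 2) := by
  refine csSup_le' ?_
  rintro _ ⟨X, hX, hanti, rfl⟩
  exact card_le_of_isAntichain hX hanti

lemma le_of_sba_or_tra {u t s p q : ℕ} (hts : t ≤ s) (h : p + q = sba u t ∨ (p, q) ∈ tra u t) :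
    p ≤ 2 ^ (s - 2) ∧ q ≤ 2 ^ (s - 2) := by
  have hle : 2 ^ (t - 2) ≤ 2 ^ (s - 2) := Nat.pow_le_pow_right two_pos (by omega)
  rcases h with h | ⟨X, Y, hX, hY, hXa, hYa, -, h⟩
  · have := sba_le u t
    omega
  · obtain ⟨rfl, rfl⟩ := Prod.mk.inj h
    exact ⟨(card_le_of_isAntichain hX hXa).trans hle, (card_le_of_isAntichain hY hYa).trans hle⟩

lemma two_pow_mul_choose_le (j : ℕ) : 2 ^ (2 * j) * (j + 3).choose 2 ≤ 3 ^ (2 * j + 1) := by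
  induction j with
  | zero => simp
  | succ j ih =>
    have h₁ : (j + 4).choose 2 = (j + 3) + (j + 3).choose 2 := by
      rw [Nat.choose_succ_succ' (j + 3) 1, Nat.choose_one_right]
    have h₂ : (j + 3).choose 2 = (j + 2) + (j + 2).choose 2 := by
      rw [Nat.choose_succ_succ' (j + 2) 1, Nat.choose_one_right]
    have h₃ : 0 < (j + 2).choose 2 := Nat.choose_pos (by omega)
    calc 2 ^ (2 * (j + 1)) * (j + 1 + 3).choose 2
        = 4 * (2 ^ (2 * j) * (j + 4).choose 2) := by ring_nf
      _ ≤ 4 * (2 ^ (2 * j) * (2 * (j + 3).choose 2)) := by gcongr; omega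
      _ = 8 * (2 ^ (2 * j) * (j + 3).choose 2) := by ring
      _ ≤ 9 * 3 ^ (2 * j + 1) := Nat.mul_le_mul (by omega) ih
      _ = 3 ^ (2 * (j + 1) + 1) := by ring

/-- **Main Theorem, part (B).**  Let `d` be an odd positive integer and let
`m 0 < m 1 < … < m (d+1)` be odd positive integers (the paper's `m_1 < … < m_{d+2}`)
with `d ≤ m 0` and `3 ≤ m 0`.  For each index `i` let `w i = C((m i + 3)/2, 2)` and let
`p i, q i` be nonnegative integers with `p i + q i > 0` satisfying the `sba`/`tra`
conditions below (the condition for the paper's index `i ∈ {3, …, d+2}` becomes the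
condition for `2 ≤ i < d + 2` here, with `d + 3 - i_paper = d + 2 - i`).  Then the
direct product `∏_{i} (Part(m i + 4)^(p i) × Part(m i + 5)^(q i ⬝ w i))` of direct
powers of partition lattices, with componentwise operations, is four-generated. -/
theorem main_theorem_B (d : ℕ) (hd_pos : 0 < d) (hd_odd : Odd d)
    (m : ℕ → ℕ)
    (hm_odd : ∀ i < d + 2, Odd (m i))
    (hm_mono : ∀ i j, i < j → j < d + 2 → m i < m j)
    (hdm : d ≤ m 0) (hm3 : 3 ≤ m 0)
    (w : ℕ → ℕ) (hw : ∀ i, w i = Nat.choose ((m i + 3) / 2) 2)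
    (p q : ℕ → ℕ)
    (hpq : ∀ i < d + 2, 0 < p i + q i)
    (h1 : p 0 + q 0 = sba d (m 0 - 1) ∨ (p 0, q 0) ∈ tra d (m 0 - 1))
    (h2 : p 1 + q 1 = sba (m 1 - d) (m 1 - d - 1) ∨
          (p 1, q 1) ∈ tra (m 1 - d) (m 1 - d - 1))
    (h3 : ∀ i, 2 ≤ i → i < d + 2 →
          p i + q i = sba (d + 2 - i) (m i - d - 1) ∨
          (p i, q i) ∈ tra (d + 2 - i) (m i - d - 1)) :
    FourGenerated (∀ i : Fin (d + 2),
      (Fin (p i.val) → Setoid (Fin (m i.val + 4))) ×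
      (Fin (q i.val * w i.val) → Setoid (Fin (m i.val + 5)))) := by
  have hodd : ∀ i < d + 2, ∃ j, m i = 2 * j + 3 := by
    intro i hi
    obtain ⟨k, hk⟩ := hm_odd i hi
    have : m 0 ≤ m i := by
      rcases Nat.eq_zero_or_pos i with rfl | h
      · exact le_rfl
      · exact (hm_mono 0 i h hi).le
    exact ⟨k - 1, by omega⟩
  have hle : ∀ i < d + 2, p i ≤ 2 ^ (m i - 3) ∧ q i ≤ 2 ^ (m i - 3) := by
    intro i hi
    rw [← Nat.sub_sub (m i) 1 2]
    rcases i with _ | _ | i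
    · exact le_of_sba_or_tra le_rfl h1
    · exact le_of_sba_or_tra (by simp only [zero_add]; omega) h2
    · exact le_of_sba_or_tra (t := m (i + 2) - d - 1)
        (show m (i + 2) - d - 1 ≤ m (i + 2) - 1 by omega) (h3 (i + 2) (by omega) hi)
  have hqw : ∀ i < d + 2, q i * w i ≤ 3 ^ (2 * ((m i + 3) / 2) - 5) := by
    intro i hi
    obtain ⟨j, hj⟩ := hodd i hi
    have h := (hle i hi).2
    rw [hj, show 2 * j + 3 - 3 = 2 * j by omega] at h
    rw [hw, hj, show (2 * j + 3 + 3) / 2 = j + 3 by omega,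
      show 2 * (j + 3) - 5 = 2 * j + 1 by omega]
    exact (Nat.mul_le_mul_right _ h).trans (two_pow_mul_choose_le j)
  refine fourGenerated_pi_prod (m := fun i => m i.val) (K := fun i => (m i.val + 3) / 2)
    (p := fun i => p i.val) (q := fun i => q i.val * w i.val) ?_ ?_ ?_ ?_
    (fun i => hqw i i.2) ⟨0, ?_⟩
  · intro i
    obtain ⟨j, hj⟩ := hodd i i.2
    omega
  · intro i
    obtain ⟨j, hj⟩ := hodd i i.2
    omega
  · intro i k hik
    obtain ⟨j, hj⟩ := hodd i i.2
    obtain ⟨l, hl⟩ := hodd k k.2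
    have hmik : m i = m k := by
      dsimp only at hik
      omega
    rcases lt_trichotomy i k with h | h | h
    · exact absurd hmik (hm_mono i k h k.2).ne
    · exact h
    · exact absurd hmik (hm_mono k i h i.2).ne'
  · intro i
    obtain ⟨j, hj⟩ := hodd i i.2
    rw [show 2 * ((m i.val + 3) / 2) - 6 = m i.val - 3 by omega]
    exact (hle i i.2).1
  · have h₁ : 0 < w 0 := by
      rw [hw]
      exact Nat.choose_pos (by omega)
    have h₂ := hpq 0 (by omega)
    rcases Nat.eq_zero_or_pos (q 0) with h | h
    · exact Nat.add_pos_left (show 0 < p 0 by omega) _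
    · exact Nat.add_pos_right _ (Nat.mul_pos h h₁)
end
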